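/- arXiv:0902.0967 — 8 statements merged into one kernel-verified Lean document; each statement's English description precedes it below -/
import Mathlib

section
/- Let σ ⊆ N_ℝ be a strongly convex rational polyhedral cone, Q ⊆ σ a rational polyhedron with 0 ∉ Q, and Q = Q_0 + Q_1 + ⋯ + Q_k a Minkowski sum decomposition into rational polyhedra satisfying condition (*). For s ∈ σ^∨ ∩ M, let min⟨s,Q_i⟩ denote the (attained) minimum of s on Q_i and ⌊·⌋ the floor function. Then the lattice point s̃ = s − ∑_{i=1}^k ⌊min⟨s,Q_i⟩⌋ e_i* lies in σ̃^∨ ∩ M̃; explicitly, ⟨s̃,n⟩ ≥ 0 for all n ∈ σ, ⟨s̃, q_i + e_i⟩ ≥ 0 for all q_i ∈ Q_i (i = 1,…,k), and ⟨s̃, q_0 − e_1 − ⋯ − e_k⟩ ≥ 0 for all q_0 ∈ Q_0. -/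
open Pointwise

noncomputable section

/-- The standard pairing on `ℝ^d`. -/
def pr {d : ℕ} (u n : Fin d → ℝ) : ℝ := ∑ j, u j * n j

/-- The convex cone generated by a set: all finite nonnegative linear combinations. -/
def coneGen {E : Type*} [AddCommMonoid E] [Module ℝ E] (S : Set E) : Set E :=
  {x | ∃ (m : ℕ) (c : Fin m → ℝ) (v : Fin m → E),
    (∀ i, 0 ≤ c i) ∧ (∀ i, v i ∈ S) ∧ x = ∑ i, c i • v i}

/-- The dual cone of a subset of `ℝ^d`. -/
def dualCone {d : ℕ} (C : Set (Fin d → ℝ)) : Set (Fin d → ℝ) :=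
  {u | ∀ n ∈ C, 0 ≤ pr u n}

/-- A point of `ℝ^d` is a lattice point if all coordinates are integers. -/
def IsLattice {d : ℕ} (x : Fin d → ℝ) : Prop := ∀ j, ∃ z : ℤ, x j = (z : ℝ)

/-- The canonical map `ℤ^d → ℝ^d`. -/
def castd {d : ℕ} (z : Fin d → ℤ) : Fin d → ℝ := fun j => (z j : ℝ)

/-- A rational polyhedral cone: generated by finitely many rational vectors. -/
def IsRatPolyCone {d : ℕ} (σ : Set (Fin d → ℝ)) : Prop :=
  ∃ (m : ℕ) (v : Fin m → Fin d → ℚ), σ = coneGen (Set.range fun i => fun j => ((v i j : ℝ)))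

/-- Strong convexity of a cone: `σ ∩ (−σ) ⊆ {0}`. -/
def IsStronglyConvex {d : ℕ} (σ : Set (Fin d → ℝ)) : Prop := σ ∩ (-σ) ⊆ {0}

/-- A rational polyhedron: a finite intersection of rational half-spaces. -/
def IsRatPolyhedron {d : ℕ} (P : Set (Fin d → ℝ)) : Prop :=
  ∃ (m : ℕ) (A : Fin m → Fin d → ℚ) (b : Fin m → ℚ),
    P = {x | ∀ i, (b i : ℝ) ≤ ∑ j, (A i j : ℝ) * x j}

/-- The recession cone of a polyhedron. -/
def recCone {d : ℕ} (P : Set (Fin d → ℝ)) : Set (Fin d → ℝ) :=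
  {n | ∀ q ∈ P, ∀ t : ℝ, 0 ≤ t → q + t • n ∈ P}

/-- Condition (*): in any induced vertex decomposition all but at most one summand
is a lattice point. -/
def CondStar {d k : ℕ} (Q : Set (Fin d → ℝ)) (Qs : Fin (k + 1) → Set (Fin d → ℝ)) : Prop :=
  ∀ q ∈ Q.extremePoints ℝ, ∀ qs : Fin (k + 1) → Fin d → ℝ,
    (∀ i, qs i ∈ (Qs i).extremePoints ℝ) → q = ∑ i, qs i →
      ∃ i₀, ∀ i, i ≠ i₀ → IsLattice (qs i)

/-- The pairing on `ℝ^d × ℝ^k`. -/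
def prP {d k : ℕ} (u n : (Fin d → ℝ) × (Fin k → ℝ)) : ℝ := pr u.1 n.1 + pr u.2 n.2

/-- The dual cone of a subset of `ℝ^d × ℝ^k`. -/
def dualConeP {d k : ℕ} (C : Set ((Fin d → ℝ) × (Fin k → ℝ))) :
    Set ((Fin d → ℝ) × (Fin k → ℝ)) :=
  {u | ∀ n ∈ C, 0 ≤ prP u n}

/-- The generating set `σ ∪ (Q₀ − e₁ − ⋯ − e_k) ∪ (Q₁ + e₁) ∪ ⋯ ∪ (Q_k + e_k)` of `σ̃`. -/
def tildeGen {d k : ℕ} (σ : Set (Fin d → ℝ)) (Qs : Fin (k + 1) → Set (Fin d → ℝ)) :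
    Set ((Fin d → ℝ) × (Fin k → ℝ)) :=
  ((fun n => (n, (0 : Fin k → ℝ))) '' σ) ∪
    ((fun q => (q, fun _ => (-1 : ℝ))) '' Qs 0) ∪
    ⋃ i : Fin k, (fun q => (q, (Pi.single i 1 : Fin k → ℝ))) '' Qs i.succ

/-- The cone `σ̃ ⊆ Ñ_ℝ`. -/
def tildeCone {d k : ℕ} (σ : Set (Fin d → ℝ)) (Qs : Fin (k + 1) → Set (Fin d → ℝ)) :
    Set ((Fin d → ℝ) × (Fin k → ℝ)) :=
  coneGen (tildeGen σ Qs)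

/-- The canonical map `ℤ^d × ℤ^k → ℝ^d × ℝ^k`. -/
def castP {d k : ℕ} (z : (Fin d → ℤ) × (Fin k → ℤ)) : (Fin d → ℝ) × (Fin k → ℝ) :=
  (castd z.1, castd z.2)


theorem coneGen_add {E : Type*} [AddCommMonoid E] [Module ℝ E] {S : Set E} {x y : E}
    (hx : x ∈ coneGen S) (hy : y ∈ coneGen S) : x + y ∈ coneGen S := by
  obtain ⟨m, c, v, hc, hv, rfl⟩ := hx
  obtain ⟨m', c', v', hc', hv', rfl⟩ := hy
  refine ⟨m + m', Fin.append c c', Fin.append v v', ?_, ?_, ?_⟩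
  · intro i
    refine Fin.addCases (fun i => ?_) (fun i => ?_) i
    · simpa using hc i
    · simpa using hc' i
  · intro i
    refine Fin.addCases (fun i => ?_) (fun i => ?_) i
    · simpa using hv i
    · simpa using hv' i
  · simp [Fin.sum_univ_add]

theorem coneGen_smul {E : Type*} [AddCommMonoid E] [Module ℝ E] {S : Set E} {x : E} {a : ℝ}
    (ha : 0 ≤ a) (hx : x ∈ coneGen S) : a • x ∈ coneGen S := by
  obtain ⟨m, c, v, hc, hv, rfl⟩ := hx
  exact ⟨m, fun i => a * c i, v, fun i => mul_nonneg ha (hc i), hv, by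
    simp [Finset.smul_sum, mul_smul]⟩

theorem subset_coneGen {E : Type*} [AddCommMonoid E] [Module ℝ E] (S : Set E) :
    S ⊆ coneGen S := fun x hx =>
  ⟨1, fun _ => 1, fun _ => x, fun _ => zero_le_one, fun _ => hx, by simp⟩

theorem exists_bound {d : ℕ} {σ : Set (Fin d → ℝ)} (h : IsRatPolyCone σ)
    (hsc : IsStronglyConvex σ) :
    ∃ (u : (Fin d → ℝ) →L[ℝ] ℝ) (C : ℝ), 0 ≤ C ∧ ∀ x ∈ σ, ‖x‖ ≤ C * u x := by
  obtain ⟨m, v, hv⟩ := h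
  set w : Fin m → Fin d → ℝ := fun i => fun j => ((v i j : ℝ)) with hw
  have hconv : Convex ℝ (σ \ {0}) := by
    rintro x ⟨hx, hx0⟩ y ⟨hy, hy0⟩ a b ha hb hab
    have hax : a • x ∈ σ := by rw [hv] at hx ⊢; exact coneGen_smul ha hx
    have hby : b • y ∈ σ := by rw [hv] at hy ⊢; exact coneGen_smul hb hy
    refine ⟨by rw [hv] at hax hby ⊢; exact coneGen_add hax hby, ?_⟩
    intro h0
    have h0 : a • x + b • y = 0 := h0
    have h1 : a • x = 0 := hsc ⟨hax, by
      rw [Set.mem_neg, neg_eq_of_add_eq_zero_right h0]; exact hby⟩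
    have h2 : b • y = 0 := by simpa [h1] using h0
    have ha0 : a = 0 := (smul_eq_zero.1 h1).resolve_right hx0
    have hb0 : b = 0 := (smul_eq_zero.1 h2).resolve_right hy0
    rw [ha0, hb0] at hab
    norm_num at hab
  have hfin : (Set.range w \ {0}).Finite := (Set.finite_range w).subset Set.sdiff_subset
  have hsub : convexHull ℝ (Set.range w \ {0}) ⊆ σ \ {0} := by
    refine convexHull_min ?_ hconv
    refine Set.sdiff_subset_sdiff_left ?_
    rw [hv]; exact subset_coneGen _
  have h0 : (0 : Fin d → ℝ) ∉ convexHull ℝ (Set.range w \ {0}) := fun h => (hsub h).2 rfl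
  obtain ⟨f, e, he, hf⟩ := geometric_hahn_banach_point_closed (convex_convexHull ℝ _)
    (hfin.isCompact_convexHull ℝ).isClosed h0
  rw [map_zero] at he
  have hK : 0 ≤ ∑ i, ‖w i‖ := Finset.sum_nonneg fun i _ => norm_nonneg _
  have hC : 0 ≤ (∑ i, ‖w i‖) / e := by positivity
  refine ⟨f, (∑ i, ‖w i‖) / e, hC, ?_⟩
  have hgen : ∀ y ∈ Set.range w, ‖y‖ ≤ (∑ i, ‖w i‖) / e * f y := by
    rintro y ⟨i, rfl⟩
    by_cases hi : w i = 0
    · simp [hi]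
    · have h1 : e ≤ f (w i) := (hf _ (subset_convexHull ℝ _ ⟨⟨i, rfl⟩, hi⟩)).le
      have h2 : ‖w i‖ ≤ ∑ i, ‖w i‖ :=
        Finset.single_le_sum (f := fun i => ‖w i‖) (fun i _ => norm_nonneg _) (Finset.mem_univ i)
      calc ‖w i‖ ≤ (∑ i, ‖w i‖) / e * e := by rw [div_mul_cancel₀ _ he.ne']; exact h2
        _ ≤ _ := by gcongr
  intro x hx
  rw [hv] at hx
  obtain ⟨n, c, y, hc, hy, rfl⟩ := hx
  calc ‖∑ i, c i • y i‖ ≤ ∑ i, ‖c i • y i‖ := norm_sum_le _ _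
    _ ≤ ∑ i, c i * ((∑ i, ‖w i‖) / e * f (y i)) := by
        refine Finset.sum_le_sum fun i _ => ?_
        rw [norm_smul, Real.norm_of_nonneg (hc i)]
        exact mul_le_mul_of_nonneg_left (hgen _ (hy i)) (hc i)
    _ = _ := by
        rw [map_sum, Finset.mul_sum]
        refine Finset.sum_congr rfl fun i _ => ?_
        rw [map_smul, smul_eq_mul]; ring

/-- The pairing as a continuous linear map. -/
def prL {d : ℕ} (u : Fin d → ℝ) : (Fin d → ℝ) →L[ℝ] ℝ :=
  ∑ j, u j • ContinuousLinearMap.proj (R := ℝ) (φ := fun _ : Fin d => ℝ) j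

theorem prL_apply {d : ℕ} (u n : Fin d → ℝ) : prL u n = pr u n := by
  simp [prL, pr]

theorem isClosed_ratPoly {d : ℕ} {P : Set (Fin d → ℝ)} (h : IsRatPolyhedron P) : IsClosed P := by
  obtain ⟨m, A, b, rfl⟩ := h
  rw [Set.ofPred_forall]
  exact isClosed_iInter fun i => isClosed_le (by fun_prop) (by fun_prop)

/-- A minimum face has an extreme point. -/
theorem exists_vertex {d : ℕ} {σ Q : Set (Fin d → ℝ)} (h : IsRatPolyCone σ)
    (hsc : IsStronglyConvex σ) (hQσ : Q ⊆ σ) (hQ : IsClosed Q)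
    (g : (Fin d → ℝ) →L[ℝ] ℝ) (x₀ : Fin d → ℝ) (hx₀ : x₀ ∈ Q) (hmin : ∀ x ∈ Q, g x₀ ≤ g x) :
    ∃ q ∈ Q.extremePoints ℝ, g q = g x₀ := by
  obtain ⟨u, C, hC, hu⟩ := exists_bound h hsc
  set F : Set (Fin d → ℝ) := {x | x ∈ Q ∧ g x = g x₀} with hF
  have hFc : IsClosed F := hQ.inter (isClosed_eq g.continuous continuous_const)
  have hGc : IsCompact (F ∩ {x | u x ≤ u x₀}) := by
    refine Metric.isCompact_of_isClosed_isBounded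
      (hFc.inter (isClosed_le u.continuous continuous_const)) ?_
    refine (isBounded_iff_forall_norm_le).2 ⟨C * u x₀, fun x hx => ?_⟩
    exact (hu x (hQσ hx.1.1)).trans (mul_le_mul_of_nonneg_left hx.2 hC)
  obtain ⟨x₁, hx₁, hm₁⟩ := hGc.exists_isMinOn ⟨x₀, ⟨hx₀, rfl⟩, le_refl (u x₀)⟩
    u.continuous.continuousOn
  have hm : ∀ x ∈ F, u x₁ ≤ u x := by
    intro x hx
    by_cases hxu : u x ≤ u x₀
    · exact hm₁ ⟨hx, hxu⟩
    · exact hx₁.2.trans (not_le.1 hxu).le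
  set H : Set (Fin d → ℝ) := {x | x ∈ F ∧ u x = u x₁} with hH
  have hHc : IsCompact H := by
    refine hGc.of_isClosed_subset
      (hFc.inter (isClosed_eq u.continuous continuous_const)) ?_
    rintro x ⟨hx, hxu⟩
    exact ⟨hx, hxu.le.trans hx₁.2⟩
  obtain ⟨q, hq⟩ := hHc.extremePoints_nonempty ⟨x₁, hx₁.1, rfl⟩
  refine ⟨q, ⟨hq.1.1.1, ?_⟩, hq.1.1.2⟩
  have key : ∀ (L : (Fin d → ℝ) →L[ℝ] ℝ) (a b : Fin d → ℝ), q ∈ openSegment ℝ a b →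
      L q ≤ L a → L q ≤ L b → L a = L q ∧ L b = L q := by
    rintro L a b ⟨α, β, hα, hβ, hab, hqq⟩ h1 h2
    have h3 : α * L a + β * L b = L q := by rw [← hqq]; simp
    have hβ' : β = 1 - α := by linarith
    subst hβ'
    constructor
    · nlinarith [mul_nonneg hα.le (sub_nonneg.2 h1), mul_nonneg hβ.le (sub_nonneg.2 h2)]
    · nlinarith [mul_nonneg hα.le (sub_nonneg.2 h1), mul_nonneg hβ.le (sub_nonneg.2 h2)]
  intro a ha b hb hseg
  have hgq := hq.1.1.2
  have huq := hq.1.2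
  obtain ⟨h1, h2⟩ := key g a b hseg (hgq ▸ hmin a ha) (hgq ▸ hmin b hb)
  have haF : a ∈ F := ⟨ha, h1.trans hgq⟩
  have hbF : b ∈ F := ⟨hb, h2.trans hgq⟩
  obtain ⟨h3, h4⟩ := key u a b hseg (huq ▸ hm a haF) (huq ▸ hm b hbF)
  exact hq.2 ⟨haF, h3.trans huq⟩ ⟨hbF, h4.trans huq⟩ hseg

theorem extreme_summand {d n : ℕ} {Qs : Fin n → Set (Fin d → ℝ)} (qs : Fin n → Fin d → ℝ)
    (hqs : ∀ i, qs i ∈ Qs i) (h : ∑ i, qs i ∈ (∑ i, Qs i).extremePoints ℝ) (i : Fin n) :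
    qs i ∈ (Qs i).extremePoints ℝ := by
  classical
  refine ⟨hqs i, ?_⟩
  have hsum : ∀ a, ∑ j, Function.update qs i a j = a + ∑ j ∈ Finset.univ \ {i}, qs j := fun a =>
    Finset.sum_update_of_mem (Finset.mem_univ i) qs a
  have hmem : ∀ a ∈ Qs i, a + ∑ j ∈ Finset.univ \ {i}, qs j ∈ ∑ j, Qs j := by
    intro a ha
    rw [← hsum a]
    refine (Set.mem_fintype_sum _ _).2 ⟨Function.update qs i a, fun j => ?_, rfl⟩
    by_cases hj : j = i
    · subst hj; simpa using ha
    · simpa [hj] using hqs j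
  have hself : ∑ j, qs j = qs i + ∑ j ∈ Finset.univ \ {i}, qs j := by
    rw [← hsum (qs i), Function.update_eq_self]
  intro a ha b hb hseg
  have := h.2 (hmem a ha) (hmem b hb) (by
    rw [hself]
    obtain ⟨α, β, hα, hβ, hab, hq⟩ := hseg
    refine ⟨α, β, hα, hβ, hab, ?_⟩
    rw [← hq, smul_add, smul_add]
    have : ∀ R : Fin d → ℝ, R = α • R + β • R := fun R => by rw [← add_smul, hab, one_smul]
    conv_rhs => rw [this (∑ j ∈ Finset.univ \ {i}, qs j)]
    abel)
  rw [hself] at this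
  exact add_right_cancel this

theorem pr_int {d : ℕ} (s : Fin d → ℤ) {x : Fin d → ℝ} (hx : IsLattice x) :
    ∃ z : ℤ, pr (castd s) x = z := by
  choose z hz using hx
  exact ⟨∑ j, s j * z j, by simp [pr, castd, hz]⟩

/-- for `s ∈ σ^∨ ∩ M`, the lattice point
`s̃ = s − ∑_{i=1}^k ⌊min⟨s,Q_i⟩⌋ e_i*` lies in `σ̃^∨ ∩ M̃`, with the explicit inequalities. -/
theorem tilde_s_mem_dual {d k : ℕ}
    (σ Q : Set (Fin d → ℝ)) (Qs : Fin (k + 1) → Set (Fin d → ℝ))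
    (hσrat : IsRatPolyCone σ) (hσsc : IsStronglyConvex σ)
    (hQrat : IsRatPolyhedron Q) (hQσ : Q ⊆ σ) (hQ0 : (0 : Fin d → ℝ) ∉ Q)
    (hQsrat : ∀ i, IsRatPolyhedron (Qs i))
    (hdec : Q = ∑ i, Qs i)
    (hrec : ∀ i i', recCone (Qs i) = recCone (Qs i'))
    (hstar : CondStar Q Qs)
    (s : Fin d → ℤ) (hs : castd s ∈ dualCone σ)
    -- `min⟨s,Q_i⟩`, the (attained) minimum of `s` on `Q_i`
    (μ : Fin (k + 1) → ℝ)
    (hμ : ∀ i, μ i ∈ (pr (castd s)) '' Qs i ∧ ∀ q ∈ Qs i, μ i ≤ pr (castd s) q) :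
    (∀ n ∈ σ, 0 ≤ pr (castd s) n) ∧
    (∀ i : Fin k, ∀ q ∈ Qs i.succ, 0 ≤ pr (castd s) q - (⌊μ i.succ⌋ : ℝ)) ∧
    (∀ q ∈ Qs 0, 0 ≤ pr (castd s) q + ∑ i : Fin k, (⌊μ i.succ⌋ : ℝ)) ∧
    castP (s, fun i => -⌊μ i.succ⌋) ∈ dualConeP (tildeCone σ Qs) := by
  have hne : ∀ i, ∃ x ∈ Qs i, pr (castd s) x = μ i := fun i => (hμ i).1
  choose p hp hpμ using hne
  have hpsum : ∀ f : Fin (k + 1) → Fin d → ℝ,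
      prL (castd s) (∑ i, f i) = ∑ i, pr (castd s) (f i) := by
    intro f
    rw [map_sum]; simp only [prL_apply]
  have hpQ : ∑ i, p i ∈ Q := by
    rw [hdec]; exact (Set.mem_fintype_sum _ _).2 ⟨p, hp, rfl⟩
  have hmin : ∀ x ∈ Q, prL (castd s) (∑ i, p i) ≤ prL (castd s) x := by
    intro x hx
    rw [hdec] at hx
    obtain ⟨f, hf, rfl⟩ := (Set.mem_fintype_sum _ _).1 hx
    rw [hpsum, hpsum]
    refine Finset.sum_le_sum fun i _ => ?_
    rw [hpμ]; exact (hμ i).2 _ (hf i)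
  obtain ⟨q, hq, hqm⟩ := exists_vertex hσrat hσsc hQσ (isClosed_ratPoly hQrat)
    (prL (castd s)) _ hpQ hmin
  have hqQ := hq.1
  rw [hdec] at hqQ
  obtain ⟨qs, hqs, hqeq⟩ := (Set.mem_fintype_sum _ _).1 hqQ
  have hext : ∀ i, qs i ∈ (Qs i).extremePoints ℝ :=
    extreme_summand qs hqs (by rw [hqeq, ← hdec]; exact hq)
  have hsumμ : ∑ i, pr (castd s) (qs i) = ∑ i, μ i := by
    rw [← hpsum, hqeq, hqm, hpsum]; simp only [hpμ]
  have hval : ∀ i, μ i = pr (castd s) (qs i) := by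
    have := (Finset.sum_eq_sum_iff_of_le
      (fun i (_ : i ∈ Finset.univ) => (hμ i).2 (qs i) (hqs i))).1 hsumμ.symm
    exact fun i => this i (Finset.mem_univ i)
  obtain ⟨i₀, hi₀⟩ := hstar q hq qs hext hqeq.symm
  have hint : ∀ i, i ≠ i₀ → ((⌊μ i⌋ : ℤ) : ℝ) = μ i := by
    intro i hi
    obtain ⟨z, hz⟩ := pr_int s (hi₀ i hi)
    rw [hval, hz, Int.floor_intCast]
  have hnonneg : 0 ≤ μ 0 + ∑ i : Fin k, μ i.succ := by
    rw [← Fin.sum_univ_succ, ← hsumμ, ← hpsum, hqeq, prL_apply]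
    exact hs q (hQσ hq.1)
  have hmain : 0 ≤ μ 0 + ∑ i : Fin k, (⌊μ i.succ⌋ : ℝ) := by
    by_cases h0 : i₀ = 0
    · have : ∀ i : Fin k, (⌊μ i.succ⌋ : ℝ) = μ i.succ := fun i =>
        hint _ (by rw [h0]; exact Fin.succ_ne_zero i)
      simpa only [this] using hnonneg
    · have hm0 := hint 0 (Ne.symm h0)
      obtain ⟨j, rfl⟩ := Fin.exists_succ_eq.2 h0
      have hlt : ∑ i : Fin k, μ i.succ < ∑ i : Fin k, (⌊μ i.succ⌋ : ℝ) + 1 := by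
        rw [← Finset.add_sum_erase _ _ (Finset.mem_univ j),
          ← Finset.add_sum_erase _ (fun i : Fin k => (⌊μ i.succ⌋ : ℝ)) (Finset.mem_univ j)]
        have : ∑ i ∈ Finset.univ.erase j, (⌊μ i.succ⌋ : ℝ)
            = ∑ i ∈ Finset.univ.erase j, μ i.succ := Finset.sum_congr rfl fun i hi =>
          hint _ (fun h => Finset.ne_of_mem_erase hi (Fin.succ_injective _ h))
        rw [this]
        linarith [Int.lt_floor_add_one (μ j.succ)]
      have h1 : (-1 : ℝ) < ((⌊μ 0⌋ + ∑ i : Fin k, ⌊μ i.succ⌋ : ℤ) : ℝ) := by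
        push_cast
        linarith
      have h2 : (-1 : ℤ) < ⌊μ 0⌋ + ∑ i : Fin k, ⌊μ i.succ⌋ := by exact_mod_cast h1
      have h3 : (0 : ℤ) ≤ ⌊μ 0⌋ + ∑ i : Fin k, ⌊μ i.succ⌋ := by omega
      have h4 : (0 : ℝ) ≤ ((⌊μ 0⌋ + ∑ i : Fin k, ⌊μ i.succ⌋ : ℤ) : ℝ) := by exact_mod_cast h3
      push_cast at h4
      linarith
  have c1 : ∀ n ∈ σ, 0 ≤ pr (castd s) n := hs
  have c2 : ∀ i : Fin k, ∀ q ∈ Qs i.succ, 0 ≤ pr (castd s) q - (⌊μ i.succ⌋ : ℝ) := by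
    intro i q hq
    linarith [(hμ i.succ).2 q hq, Int.floor_le (μ i.succ)]
  have c3 : ∀ q ∈ Qs 0, 0 ≤ pr (castd s) q + ∑ i : Fin k, (⌊μ i.succ⌋ : ℝ) := by
    intro q hq
    linarith [(hμ 0).2 q hq]
  refine ⟨c1, c2, c3, ?_⟩
  rintro n ⟨m, c, v, hc, hv, rfl⟩
  have hlin : prP (castP (s, fun i => -⌊μ i.succ⌋)) (∑ i, c i • v i)
      = ∑ i, c i * prP (castP (s, fun i => -⌊μ i.succ⌋)) (v i) := by
    simp only [prP, ← prL_apply, Prod.fst_sum, Prod.snd_sum, map_sum, Prod.smul_fst,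
      Prod.smul_snd, map_smul, smul_eq_mul, mul_add, Finset.sum_add_distrib]
  rw [hlin]
  refine Finset.sum_nonneg fun i _ => mul_nonneg (hc i) ?_
  rcases hv i with (⟨x, hx, hxe⟩ | ⟨x, hx, hxe⟩) | hx
  · rw [← hxe]
    simpa [prP, castP, pr] using c1 x hx
  · rw [← hxe]
    have := c3 x hx
    simpa [prP, castP, pr, castd] using this
  · obtain ⟨j, x, hx, hxe⟩ := Set.mem_iUnion.1 hx
    rw [← hxe]
    have := c2 j x hx
    simpa [prP, castP, pr, castd, Pi.single_apply] using this
end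
end

section
/- Let σ ⊆ N_ℝ be a strongly convex rational polyhedral cone, Q ⊆ σ a rational polyhedron with 0 ∉ Q, and Q = Q_0 + Q_1 + ⋯ + Q_k a Minkowski sum decomposition into rational polyhedra. Let u be an interior point of σ^∨ such that min⟨u,Q⟩ > 0 (the minimum being attained since Q is a polyhedron on which u is bounded below). Then the element ũ = u − ∑_{i=1}^k min⟨u,Q_i⟩ e_i* + (min⟨u,Q⟩/(k+1)) ∑_{i=1}^k e_i* of M̃_ℝ is strictly positive on every nonzero element of σ and on every point of Q_0 − e_1 − ⋯ − e_k and of Q_i + e_i for i = 1,…,k; consequently ũ is strictly positive on σ̃ \ {0}. -/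
open Pointwise

noncomputable section

theorem aux_pr_add {d : ℕ} (u x y : Fin d → ℝ) : pr u (x + y) = pr u x + pr u y := by
  simp [pr, mul_add, Finset.sum_add_distrib]

theorem aux_pr_smul {d : ℕ} (u x : Fin d → ℝ) (c : ℝ) : pr u (c • x) = c * pr u x := by
  simp only [pr, Finset.mul_sum, Pi.smul_apply, smul_eq_mul]
  exact Finset.sum_congr rfl fun _ _ => by ring

theorem aux_pr_sum {d : ℕ} {ι : Type*} (s : Finset ι) (u : Fin d → ℝ) (f : ι → Fin d → ℝ) :
    pr u (∑ i ∈ s, f i) = ∑ i ∈ s, pr u (f i) := by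
  simp only [pr, Finset.sum_apply, Finset.mul_sum]
  exact Finset.sum_comm

theorem aux_prP_sum {d k m : ℕ} (u : (Fin d → ℝ) × (Fin k → ℝ)) (c : Fin m → ℝ)
    (v : Fin m → (Fin d → ℝ) × (Fin k → ℝ)) :
    prP u (∑ i, c i • v i) = ∑ i, c i * prP u (v i) := by
  simp only [prP, Prod.fst_sum, Prod.snd_sum, aux_pr_sum, Prod.smul_fst, Prod.smul_snd,
    aux_pr_smul, mul_add, Finset.sum_add_distrib]

theorem aux_interior {d : ℕ} (σ : Set (Fin d → ℝ)) (u : Fin d → ℝ)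
    (hu : u ∈ interior (dualCone σ)) (n : Fin d → ℝ) (hn : n ∈ σ) (h0 : n ≠ 0) :
    0 < pr u n := by
  have hc : Filter.Tendsto (fun t : ℝ => u - t • n) (nhds 0) (nhds u) := by
    have : Continuous (fun t : ℝ => u - t • n) := by fun_prop
    simpa using this.tendsto 0
  have h1 := hc.eventually (mem_interior_iff_mem_nhds.1 hu)
  have h2 : ∀ᶠ t : ℝ in nhdsWithin 0 (Set.Ioi 0), u - t • n ∈ dualCone σ :=
    h1.filter_mono nhdsWithin_le_nhds
  obtain ⟨t, ht, htpos⟩ := (h2.and self_mem_nhdsWithin).exists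
  have h3 := ht n hn
  have h4 : pr (u - t • n) n = pr u n - t * pr n n := by
    simp only [pr, Finset.mul_sum, ← Finset.sum_sub_distrib]
    exact Finset.sum_congr rfl fun _ _ => by simp; ring
  have h5 : 0 < pr n n := by
    obtain ⟨j, hj⟩ := Function.ne_iff.1 h0
    exact Finset.sum_pos' (fun _ _ => mul_self_nonneg _)
      ⟨j, Finset.mem_univ _, mul_self_pos.2 hj⟩
  have h6 : 0 < t * pr n n := mul_pos htpos h5
  linarith

/-- proof of Lemma 2.7: the functional
`ũ = u − ∑ min⟨u,Q_i⟩ e_i* + (min⟨u,Q⟩/(k+1)) ∑ e_i*` is strictly positive on all the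
generators of `σ̃`, and hence on `σ̃ \ {0}`. -/
theorem tilde_u_strictly_positive {d k : ℕ}
    (σ Q : Set (Fin d → ℝ)) (Qs : Fin (k + 1) → Set (Fin d → ℝ))
    (hσrat : IsRatPolyCone σ) (hσsc : IsStronglyConvex σ)
    (hQrat : IsRatPolyhedron Q) (hQσ : Q ⊆ σ) (hQ0 : (0 : Fin d → ℝ) ∉ Q)
    (hQsrat : ∀ i, IsRatPolyhedron (Qs i))
    (hdec : Q = ∑ i, Qs i)
    (hrec : ∀ i i', recCone (Qs i) = recCone (Qs i'))
    (u : Fin d → ℝ) (hu : u ∈ interior (dualCone σ))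
    -- `μQ = min⟨u,Q⟩`, the attained minimum of `u` on `Q`, assumed positive
    (μQ : ℝ) (hμQ : μQ ∈ (pr u) '' Q ∧ ∀ q ∈ Q, μQ ≤ pr u q) (hμQpos : 0 < μQ)
    -- `μ i = min⟨u,Q_i⟩`, the attained minimum of `u` on `Q_i`
    (μ : Fin (k + 1) → ℝ)
    (hμ : ∀ i, μ i ∈ (pr u) '' Qs i ∧ ∀ q ∈ Qs i, μ i ≤ pr u q) :
    (∀ n ∈ σ, n ≠ 0 → 0 < prP (u, fun i => -μ i.succ + μQ / (k + 1)) (n, 0)) ∧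
    (∀ q ∈ Qs 0, 0 < prP (u, fun i => -μ i.succ + μQ / (k + 1)) (q, fun _ => -1)) ∧
    (∀ i : Fin k, ∀ q ∈ Qs i.succ,
      0 < prP (u, fun i => -μ i.succ + μQ / (k + 1)) (q, Pi.single i 1)) ∧
    (∀ x ∈ tildeCone σ Qs, x ≠ 0 →
      0 < prP (u, fun i => -μ i.succ + μQ / (k + 1)) x) := by
  have hk : (0 : ℝ) < k + 1 := by positivity
  have hε : 0 < μQ / (k + 1) := div_pos hμQpos hk
  have A : ∀ n ∈ σ, n ≠ 0 → 0 < prP (u, fun i : Fin k => -μ i.succ + μQ / (k + 1)) (n, 0) := by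
    intro n hn h0
    have := aux_interior σ u hu n hn h0
    simpa [prP, pr] using this
  have hsum : μQ ≤ ∑ i, μ i := by
    choose q hq hqμ using fun i => (hμ i).1
    have hmem : ∑ i, q i ∈ Q := by
      rw [hdec]
      exact Set.finsetSum_mem_finsetSum _ _ _ fun i _ => hq i
    have := hμQ.2 _ hmem
    rw [aux_pr_sum] at this
    simpa [hqμ] using this
  have B : ∀ q ∈ Qs 0,
      0 < prP (u, fun i : Fin k => -μ i.succ + μQ / (k + 1)) (q, fun _ => -1) := by
    intro q hq
    have h1 := (hμ 0).2 q hq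
    rw [Fin.sum_univ_succ] at hsum
    have h2 : pr (fun i : Fin k => -μ i.succ + μQ / (k + 1)) (fun _ => -1)
        = ∑ i : Fin k, μ i.succ - k * (μQ / (k + 1)) := by
      simp [pr, Finset.sum_add_distrib]
      ring
    have h3 : μQ = k * (μQ / (k + 1)) + μQ / (k + 1) := by field_simp
    simp only [prP, h2]
    linarith
  have C : ∀ i : Fin k, ∀ q ∈ Qs i.succ,
      0 < prP (u, fun i : Fin k => -μ i.succ + μQ / (k + 1)) (q, Pi.single i 1) := by
    intro i q hq
    have h1 := (hμ i.succ).2 q hq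
    have h2 : pr (fun i : Fin k => -μ i.succ + μQ / (k + 1)) (Pi.single i 1)
        = -μ i.succ + μQ / (k + 1) := by
      simp [pr, Pi.single_apply]
    simp only [prP, h2]
    linarith
  refine ⟨A, B, C, ?_⟩
  have G : ∀ y ∈ tildeGen σ Qs, y ≠ 0 →
      0 < prP (u, fun i : Fin k => -μ i.succ + μQ / (k + 1)) y := by
    rintro y ((⟨n, hn, rfl⟩ | ⟨q, hq, rfl⟩) | hy) h0
    · exact A n hn fun h => h0 (by simp [h])
    · exact B q hq
    · obtain ⟨i, q, hq, rfl⟩ := Set.mem_iUnion.1 hy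
      exact C i q hq
  rintro x ⟨m, c, v, hc, hv, rfl⟩ hx
  obtain ⟨j, -, hj⟩ := Finset.exists_ne_zero_of_sum_ne_zero hx
  rw [aux_prP_sum]
  refine Finset.sum_pos' (fun i _ => ?_) ⟨j, Finset.mem_univ _, ?_⟩
  · by_cases h : v i = 0
    · simp [h, prP, pr]
    · exact mul_nonneg (hc i) (G _ (hv i) h).le
  · exact mul_pos ((hc j).lt_of_ne fun h => hj (by simp [← h]))
      (G _ (hv j) fun h => hj (by simp [h]))
end
end

section
/- Let σ ⊆ N_ℝ be a strongly convex rational polyhedral cone, R ∈ σ^∨ ∩ M, and let σ(−R) = {n ∈ σ : ⟨R,n⟩ = 1} be nonempty with a Minkowski sum decomposition σ(−R) = Q_0 + Q_1 + ⋯ + Q_k into rational polyhedra with common recession cone σ ∩ R^⊥, satisfying condition (*) and condition (**). Let σ̃ be the associated cone in Ñ_ℝ. Then the kernel of the ℂ-algebra homomorphism from the monoid algebra ℂ[σ̃^∨ ∩ M̃] to the monoid algebra ℂ[σ^∨ ∩ M] induced by the projection M̃ → M is the ideal generated by the k elements χ^{R+e_i*} − χ^R (i = 1,…,k), and these k elements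 form a regular sequence in ℂ[σ̃^∨ ∩ M̃]. -/
open Pointwise

noncomputable section

/-- The submonoid `σ^∨ ∩ M` of the lattice `M = ℤ^d`. -/
def dualLat {d : ℕ} (σ : Set (Fin d → ℝ)) : AddSubmonoid (Fin d → ℤ) where
  carrier := {u | castd u ∈ dualCone σ}
  zero_mem' := by
    intro n hn
    simp [castd, pr]
  add_mem' := by
    intro a b ha hb n hn
    have h1 := ha n hn
    have h2 := hb n hn
    simp only [castd, pr] at h1 h2 ⊢
    have he : ∀ j ∈ Finset.univ, (((a + b) j : ℤ) : ℝ) * n j =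
        (a j : ℝ) * n j + (b j : ℝ) * n j := by
      intro j _
      simp only [Pi.add_apply]
      push_cast
      ring
    rw [Finset.sum_congr rfl he, Finset.sum_add_distrib]
    exact add_nonneg h1 h2

/-- The submonoid `C^∨ ∩ M̃` of the lattice `M̃ = ℤ^d × ℤ^k`. -/
def dualLatP {d k : ℕ} (C : Set ((Fin d → ℝ) × (Fin k → ℝ))) :
    AddSubmonoid ((Fin d → ℤ) × (Fin k → ℤ)) where
  carrier := {u | castP u ∈ dualConeP C}
  zero_mem' := by
    intro n hn
    simp [castP, castd, prP, pr]
  add_mem' := by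
    intro a b ha hb n hn
    have h1 := ha n hn
    have h2 := hb n hn
    simp only [castP, castd, prP, pr] at h1 h2 ⊢
    have he1 : ∀ j ∈ Finset.univ, (((a + b).1 j : ℤ) : ℝ) * n.1 j =
        (a.1 j : ℝ) * n.1 j + (b.1 j : ℝ) * n.1 j := by
      intro j _; simp only [Prod.fst_add, Prod.snd_add, Pi.add_apply]; push_cast; ring
    have he2 : ∀ j ∈ Finset.univ, (((a + b).2 j : ℤ) : ℝ) * n.2 j =
        (a.2 j : ℝ) * n.2 j + (b.2 j : ℝ) * n.2 j := by
      intro j _; simp only [Prod.fst_add, Prod.snd_add, Pi.add_apply]; push_cast; ring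
    rw [Finset.sum_congr rfl he1, Finset.sum_congr rfl he2, Finset.sum_add_distrib,
      Finset.sum_add_distrib]
    linarith

lemma mem_coneGen_self {E : Type*} [AddCommMonoid E] [Module ℝ E] {S : Set E} {x : E}
    (hx : x ∈ S) : x ∈ coneGen S :=
  ⟨1, fun _ => 1, fun _ => x, fun _ => zero_le_one, fun _ => hx, by simp⟩

lemma fst_mem_dualLat {d k : ℕ} (σ : Set (Fin d → ℝ)) (Qs : Fin (k + 1) → Set (Fin d → ℝ))
    {x : (Fin d → ℤ) × (Fin k → ℤ)} (hx : x ∈ dualLatP (tildeCone σ Qs)) :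
    x.1 ∈ dualLat σ := by
  intro n hn
  have hmem : ((n, (0 : Fin k → ℝ)) : (Fin d → ℝ) × (Fin k → ℝ)) ∈ tildeCone σ Qs :=
    mem_coneGen_self (Or.inl (Or.inl ⟨n, hn, rfl⟩))
  have h := hx _ hmem
  have h0 : pr (castd x.2) (0 : Fin k → ℝ) = 0 := by simp [pr]
  simpa [prP, castP, h0] using h

/-- The additive monoid map `σ̃^∨ ∩ M̃ → σ^∨ ∩ M` induced by the projection `M̃ → M`. -/
def projHom {d k : ℕ} (σ : Set (Fin d → ℝ)) (Qs : Fin (k + 1) → Set (Fin d → ℝ)) :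
    ↥(dualLatP (tildeCone σ Qs)) →+ ↥(dualLat σ) where
  toFun x := ⟨x.val.1, fst_mem_dualLat σ Qs x.property⟩
  map_zero' := rfl
  map_add' := fun _ _ => rfl

/-- `χ^m` in the monoid algebra `ℂ[S]`, for `m` a lattice point (lying in `S`). -/
noncomputable def chi {G : Type*} [AddZeroClass G] (S : AddSubmonoid G) (m : G) :
    AddMonoidAlgebra ℂ ↥S := by
  classical exact if h : m ∈ S then AddMonoidAlgebra.single (⟨m, h⟩ : ↥S) (1 : ℂ) else 0

section Helpers

lemma pr_add_left {d : ℕ} (u v n : Fin d → ℝ) : pr (u + v) n = pr u n + pr v n := by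
  simp [pr, add_mul, Finset.sum_add_distrib]

lemma pr_sub_left {d : ℕ} (u v n : Fin d → ℝ) : pr (u - v) n = pr u n - pr v n := by
  simp [pr, sub_mul, Finset.sum_sub_distrib]

lemma pr_smul_right {d : ℕ} (u n : Fin d → ℝ) (c : ℝ) : pr u (c • n) = c * pr u n := by
  simp only [pr, Finset.mul_sum, Pi.smul_apply, smul_eq_mul]
  exact Finset.sum_congr rfl fun j _ => by ring

lemma pr_sum_right {d : ℕ} {ι : Type*} (s : Finset ι) (u : Fin d → ℝ) (v : ι → Fin d → ℝ) :
    pr u (∑ i ∈ s, v i) = ∑ i ∈ s, pr u (v i) := by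
  simp only [pr, Finset.sum_apply, Finset.mul_sum]
  exact Finset.sum_comm

lemma castd_sub {d : ℕ} (u v : Fin d → ℤ) : castd (u - v) = castd u - castd v := by
  ext j; simp [castd]

lemma prP_coneGen {d k : ℕ} (S : Set ((Fin d → ℝ) × (Fin k → ℝ)))
    (u : (Fin d → ℝ) × (Fin k → ℝ)) (h : ∀ n ∈ S, 0 ≤ prP u n) :
    ∀ n ∈ coneGen S, 0 ≤ prP u n := by
  rintro n ⟨m, c, v, hc, hv, rfl⟩
  have : prP u (∑ i, c i • v i) = ∑ i, c i * prP u (v i) := by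
    simp only [prP, Prod.fst_sum, Prod.snd_sum, pr_sum_right, Prod.smul_fst, Prod.smul_snd,
      pr_smul_right, mul_add, Finset.sum_add_distrib]
  rw [this]
  exact Finset.sum_nonneg fun i _ => mul_nonneg (hc i) (h _ (hv i))

lemma mem_tilde_iff {d k : ℕ} (σ : Set (Fin d → ℝ)) (Qs : Fin (k + 1) → Set (Fin d → ℝ))
    (u : Fin d → ℤ) (a : Fin k → ℤ) :
    (u, a) ∈ dualLatP (tildeCone σ Qs) ↔
      (∀ n ∈ σ, 0 ≤ pr (castd u) n) ∧
      (∀ q ∈ Qs 0, 0 ≤ pr (castd u) q - ∑ i, (a i : ℝ)) ∧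
      (∀ i : Fin k, ∀ q ∈ Qs i.succ, 0 ≤ pr (castd u) q + (a i : ℝ)) := by
  have e1 : ∀ n : Fin d → ℝ, prP (castP (u, a)) (n, 0) = pr (castd u) n := by
    intro n; simp [prP, castP, pr]
  have e2 : ∀ n : Fin d → ℝ, prP (castP (u, a)) (n, fun _ => -1) =
      pr (castd u) n - ∑ i, (a i : ℝ) := by
    intro n; simp [prP, castP, pr, castd, sub_eq_add_neg]
  have e3 : ∀ (i : Fin k) (n : Fin d → ℝ), prP (castP (u, a)) (n, Pi.single i 1) =
      pr (castd u) n + (a i : ℝ) := by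
    intro i n; simp [prP, castP, pr, castd, Pi.single_apply]
  constructor
  · intro h
    refine ⟨fun n hn => ?_, fun q hq => ?_, fun i q hq => ?_⟩
    · rw [← e1]; exact h _ (mem_coneGen_self (Or.inl (Or.inl ⟨n, hn, rfl⟩)))
    · rw [← e2]; exact h _ (mem_coneGen_self (Or.inl (Or.inr ⟨q, hq, rfl⟩)))
    · rw [← e3]
      exact h _ (mem_coneGen_self (Or.inr (Set.mem_iUnion.2 ⟨i, q, hq, rfl⟩)))
  · rintro ⟨h1, h2, h3⟩
    refine prP_coneGen _ _ ?_
    rintro n ((⟨n, hn, rfl⟩ | ⟨q, hq, rfl⟩) | hn)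
    · rw [e1]; exact h1 n hn
    · rw [e2]; exact h2 q hq
    · obtain ⟨i, q, hq, rfl⟩ := Set.mem_iUnion.1 hn
      rw [e3]; exact h3 i q hq

/-- The meet of lattice points of the dual of `σ̃` over the same base point, and everything between
it and one of the two points, stays in the dual. -/
lemma mem_between {d k : ℕ} {σ : Set (Fin d → ℝ)} {Qs : Fin (k + 1) → Set (Fin d → ℝ)}
    {u : Fin d → ℤ} {a b : Fin k → ℤ}
    (ha : (u, a) ∈ dualLatP (tildeCone σ Qs)) (hba : b ≤ a)
    (hb : ∀ i : Fin k, ∀ q ∈ Qs i.succ, 0 ≤ pr (castd u) q + (b i : ℝ)) :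
    (u, b) ∈ dualLatP (tildeCone σ Qs) := by
  rw [mem_tilde_iff] at ha ⊢
  refine ⟨ha.1, fun q hq => ?_, hb⟩
  have h := ha.2.1 q hq
  have : ∑ i, (b i : ℝ) ≤ ∑ i, (a i : ℝ) :=
    Finset.sum_le_sum fun i _ => by exact_mod_cast hba i
  linarith

lemma smul_mem_ratCone {d : ℕ} {σ : Set (Fin d → ℝ)} (hσ : IsRatPolyCone σ) {n : Fin d → ℝ}
    (hn : n ∈ σ) {c : ℝ} (hc : 0 ≤ c) : c • n ∈ σ := by
  obtain ⟨m, v, rfl⟩ := hσ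
  obtain ⟨l, b, w, hb, hw, rfl⟩ := hn
  exact ⟨l, fun i => c * b i, w, fun i => mul_nonneg hc (hb i), hw, by
    simp [Finset.smul_sum, mul_smul]⟩

/-- If `(u,a)` and `(u, a - e_i)` are in the dual, then so is `(u - R, a - e_i)`. -/
lemma mem_sub_R {d k : ℕ} {σ : Set (Fin d → ℝ)} {Qs : Fin (k + 1) → Set (Fin d → ℝ)}
    (hσrat : IsRatPolyCone σ)
    {R : Fin d → ℤ} (hR : castd R ∈ dualCone σ)
    (hdec : σ ∩ {n | pr (castd R) n = 1} = ∑ i, Qs i)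
    (hss0 : Qs 0 ⊆ {n | pr (castd R) n = 1})
    (hssi : ∀ i : Fin k, Qs i.succ ⊆ {n | pr (castd R) n = 0})
    {u : Fin d → ℤ} {a : Fin k → ℤ} {i : Fin k}
    (ha : (u, a) ∈ dualLatP (tildeCone σ Qs))
    (ha' : (u, a - Pi.single i 1) ∈ dualLatP (tildeCone σ Qs)) :
    (u - R, a - Pi.single i 1) ∈ dualLatP (tildeCone σ Qs) := by
  rw [mem_tilde_iff] at ha ha' ⊢
  have hs : ∑ j, (((a - Pi.single i 1 : Fin k → ℤ) j : ℤ) : ℝ) = ∑ j, (a j : ℝ) - 1 := by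
    simp [Pi.single_apply]
  have h0 : ∀ q ∈ Qs 0, 0 ≤ pr (castd (u - R)) q -
      ∑ j, (((a - Pi.single i 1 : Fin k → ℤ) j : ℤ) : ℝ) := by
    intro q hq
    have h1 := ha.2.1 q hq
    have h2 : pr (castd R) q = 1 := hss0 hq
    rw [hs, castd_sub, pr_sub_left, h2]
    linarith
  have hi : ∀ j : Fin k, ∀ q ∈ Qs j.succ, 0 ≤ pr (castd (u - R)) q +
      (((a - Pi.single i 1 : Fin k → ℤ) j : ℤ) : ℝ) := by
    intro j q hq
    have h1 := ha'.2.2 j q hq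
    have h2 : pr (castd R) q = 0 := hssi j hq
    rw [castd_sub, pr_sub_left, h2, sub_zero]
    exact h1
  refine ⟨fun n hn => ?_, h0, hi⟩
  have hr : 0 ≤ pr (castd R) n := hR n hn
  rcases hr.eq_or_lt with hr | hr
  · rw [castd_sub, pr_sub_left, ← hr, sub_zero]
    exact ha.1 n hn
  · have hm : (pr (castd R) n)⁻¹ • n ∈ σ ∩ {n | pr (castd R) n = 1} :=
      ⟨smul_mem_ratCone hσrat hn (inv_nonneg.2 hr.le), by
        simp only [Set.mem_setOf_eq, pr_smul_right]; exact inv_mul_cancel₀ hr.ne'⟩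
    rw [hdec, Set.mem_fintype_sum] at hm
    obtain ⟨g, hg, hgs⟩ := hm
    have hp : 0 ≤ pr (castd (u - R)) ((pr (castd R) n)⁻¹ • n) := by
      rw [← hgs, pr_sum_right, Fin.sum_univ_succ]
      have h1 := h0 _ (hg 0)
      have h2 : 0 ≤ ∑ j : Fin k, (pr (castd (u - R)) (g j.succ) +
          (((a - Pi.single i 1 : Fin k → ℤ) j : ℤ) : ℝ)) :=
        Finset.sum_nonneg fun j _ => hi j _ (hg j.succ)
      rw [Finset.sum_add_distrib] at h2
      linarith
    rw [pr_smul_right] at hp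
    exact nonneg_of_mul_nonneg_right hp (inv_pos.2 hr)

/-- A criterion for the kernel of a map of monoid algebras to be contained in an ideal. -/
lemma ker_mapDomain_le {S T : Type*} [AddCommMonoid S] [AddCommMonoid T] (φ : S →+ T)
    (I : Ideal (AddMonoidAlgebra ℂ S))
    (h : ∀ s t : S, φ s = φ t →
      (AddMonoidAlgebra.single s (1 : ℂ) - AddMonoidAlgebra.single t (1 : ℂ)) ∈ I) :
    RingHom.ker (AddMonoidAlgebra.mapDomainRingHom ℂ φ) ≤ I := by
  have key : ∀ f : AddMonoidAlgebra ℂ S,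
      f - AddMonoidAlgebra.mapDomain (Function.invFun φ) (AddMonoidAlgebra.mapDomain φ f) ∈ I := by
    intro f
    induction f using AddMonoidAlgebra.induction_linear with
    | zero => simp
    | add f g hf hg =>
      rw [AddMonoidAlgebra.mapDomain_add, AddMonoidAlgebra.mapDomain_add, add_sub_add_comm]
      exact I.add_mem hf hg
    | single s r =>
      rw [AddMonoidAlgebra.mapDomain_single, AddMonoidAlgebra.mapDomain_single]
      have h1 := I.mul_mem_left (AddMonoidAlgebra.single 0 r)
        (h s (Function.invFun φ (φ s)) (Function.invFun_eq ⟨s, rfl⟩).symm)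
      simpa [mul_sub, AddMonoidAlgebra.single_mul_single] using h1
  intro f hf
  have h2 := key f
  rw [RingHom.mem_ker] at hf
  have hf' : AddMonoidAlgebra.mapDomain φ f = 0 := hf
  rwa [hf', AddMonoidAlgebra.mapDomain_zero, sub_zero] at h2

/-- Forgetting the first `j` of the last `k` coordinates. -/
def forgetHom {d k : ℕ} (S : AddSubmonoid ((Fin d → ℤ) × (Fin k → ℤ))) (j : ℕ) :
    ↥S →+ ((Fin d → ℤ) × (Fin k → ℤ)) where
  toFun x := (x.val.1, fun i => if (i : ℕ) < j then 0 else x.val.2 i)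
  map_zero' := by ext <;> simp
  map_add' x y := by
    ext i
    · simp
    · by_cases h : (i : ℕ) < j <;> simp [h]

lemma chi_of_mem {G : Type*} [AddZeroClass G] {S : AddSubmonoid G} {m : G} (h : m ∈ S) :
    chi S m = AddMonoidAlgebra.single (⟨m, h⟩ : ↥S) (1 : ℂ) := by
  simp [chi, h]

/-- Descending from `(u,a)` to `(u,b)`, one unit step at a time. -/
lemma descend {d k : ℕ} {σ : Set (Fin d → ℝ)} {Qs : Fin (k + 1) → Set (Fin d → ℝ)}
    (R : Fin d → ℤ)
    (hsub : ∀ (u : Fin d → ℤ) (a : Fin k → ℤ) (i : Fin k),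
      (u, a) ∈ dualLatP (tildeCone σ Qs) →
      (u, a - Pi.single i 1) ∈ dualLatP (tildeCone σ Qs) →
      (u - R, a - Pi.single i 1) ∈ dualLatP (tildeCone σ Qs))
    (hR0 : (R, (0 : Fin k → ℤ)) ∈ dualLatP (tildeCone σ Qs))
    (hRi : ∀ i : Fin k, (R, (0 : Fin k → ℤ)) + (0, Pi.single i 1) ∈ dualLatP (tildeCone σ Qs))
    (I : Ideal (AddMonoidAlgebra ℂ ↥(dualLatP (tildeCone σ Qs)))) (j : ℕ)
    (hI : ∀ i : Fin k, (i : ℕ) < j →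
      chi (dualLatP (tildeCone σ Qs)) ((R, 0) + (0, Pi.single i 1)) -
          chi (dualLatP (tildeCone σ Qs)) ((R, 0)) ∈ I)
    (u : Fin d → ℤ) (b : Fin k → ℤ) (hb : (u, b) ∈ dualLatP (tildeCone σ Qs)) :
    ∀ (N : ℕ) (a : Fin k → ℤ), (a, N) = (a, (∑ i, (a i - b i)).toNat) →
      b ≤ a → (∀ i : Fin k, ¬ (i : ℕ) < j → a i = b i) →
      (u, a) ∈ dualLatP (tildeCone σ Qs) →
      chi (dualLatP (tildeCone σ Qs)) (u, a) - chi (dualLatP (tildeCone σ Qs)) (u, b) ∈ I := by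
  intro N
  induction N with
  | zero =>
    intro a hN hba hj ha
    have hN' : 0 = (∑ i, (a i - b i)).toNat := (Prod.ext_iff.1 hN).2
    have h0 : ∑ i, (a i - b i) = 0 :=
      le_antisymm (by omega) (Finset.sum_nonneg fun i _ => sub_nonneg.2 (hba i))
    rw [Finset.sum_eq_zero_iff_of_nonneg fun i _ => sub_nonneg.2 (hba i)] at h0
    have : a = b := funext fun i => sub_eq_zero.1 (h0 i (Finset.mem_univ i))
    rw [this, sub_self]
    exact I.zero_mem
  | succ N ih =>
    intro a hN hba hj ha
    have hN' : N + 1 = (∑ i, (a i - b i)).toNat := (Prod.ext_iff.1 hN).2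
    obtain ⟨i, hi⟩ : ∃ i, b i < a i := by
      by_contra hcon
      push Not at hcon
      have : ∑ i, (a i - b i) ≤ 0 := Finset.sum_nonpos fun i _ => sub_nonpos.2 (hcon i)
      omega
    have hij : (i : ℕ) < j := by
      by_contra hcon
      exact hi.ne' (hj i hcon)
    have hba' : b ≤ a - Pi.single i 1 := by
      intro l
      by_cases hl : l = i
      · subst hl; simp; omega
      · simpa [hl] using hba l
    have haa : a - Pi.single i 1 ≤ a := by
      intro l
      by_cases hl : l = i
      · subst hl; simp
      · simp [hl]
    have ha' : (u, a - Pi.single i 1) ∈ dualLatP (tildeCone σ Qs) := by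
      refine mem_between ha haa fun l q hq => ?_
      have h1 := ((mem_tilde_iff σ Qs u b).1 hb).2.2 l q hq
      have h2 : (b l : ℝ) ≤ ((a - Pi.single i 1 : Fin k → ℤ) l : ℤ) := by
        exact_mod_cast hba' l
      linarith
    have hs : ∑ l, ((a - Pi.single i 1 : Fin k → ℤ) l - b l) = ∑ l, (a l - b l) - 1 := by
      have hone : ∑ l, (Pi.single i 1 : Fin k → ℤ) l = 1 := by simp [Pi.single_apply]
      simp only [Pi.sub_apply, Finset.sum_sub_distrib, hone]
      ring
    have h1 := ih (a - Pi.single i 1) (by rw [hs]; congr 1; omega) hba' (by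
      intro l hl
      have hli : l ≠ i := by rintro rfl; exact hl hij
      simpa [hli] using hj l hl) ha'
    have hm := hsub u a i ha ha'
    have h2 := I.mul_mem_left (chi (dualLatP (tildeCone σ Qs)) (u - R, a - Pi.single i 1))
      (hI i hij)
    have h3 : chi (dualLatP (tildeCone σ Qs)) (u - R, a - Pi.single i 1) *
        (chi (dualLatP (tildeCone σ Qs)) ((R, 0) + (0, Pi.single i 1)) -
          chi (dualLatP (tildeCone σ Qs)) ((R, 0))) =
        chi (dualLatP (tildeCone σ Qs)) (u, a) -
        chi (dualLatP (tildeCone σ Qs)) (u, a - Pi.single i 1) := by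
      rw [chi_of_mem hm, chi_of_mem (hRi i), chi_of_mem hR0, chi_of_mem ha, chi_of_mem ha',
        mul_sub, AddMonoidAlgebra.single_mul_single, AddMonoidAlgebra.single_mul_single, mul_one]
      congr 3
      · ext <;> simp
      · ext <;> simp
    rw [h3] at h2
    have h4 := I.add_mem h2 h1
    rwa [sub_add_sub_cancel] at h4

lemma exp_diff_mem {d k : ℕ} {σ : Set (Fin d → ℝ)} {Qs : Fin (k + 1) → Set (Fin d → ℝ)}
    (R : Fin d → ℤ)
    (hsub : ∀ (u : Fin d → ℤ) (a : Fin k → ℤ) (i : Fin k),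
      (u, a) ∈ dualLatP (tildeCone σ Qs) →
      (u, a - Pi.single i 1) ∈ dualLatP (tildeCone σ Qs) →
      (u - R, a - Pi.single i 1) ∈ dualLatP (tildeCone σ Qs))
    (hR0 : (R, (0 : Fin k → ℤ)) ∈ dualLatP (tildeCone σ Qs))
    (hRi : ∀ i : Fin k, (R, (0 : Fin k → ℤ)) + (0, Pi.single i 1) ∈ dualLatP (tildeCone σ Qs))
    (I : Ideal (AddMonoidAlgebra ℂ ↥(dualLatP (tildeCone σ Qs)))) (j : ℕ)
    (hI : ∀ i : Fin k, (i : ℕ) < j →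
      chi (dualLatP (tildeCone σ Qs)) ((R, 0) + (0, Pi.single i 1)) -
          chi (dualLatP (tildeCone σ Qs)) ((R, 0)) ∈ I)
    (s t : ↥(dualLatP (tildeCone σ Qs)))
    (hu : s.val.1 = t.val.1) (hj : ∀ i : Fin k, ¬ (i : ℕ) < j → s.val.2 i = t.val.2 i) :
    (AddMonoidAlgebra.single s (1 : ℂ) - AddMonoidAlgebra.single t (1 : ℂ)) ∈ I := by
  obtain ⟨⟨u, a⟩, ha⟩ := s
  obtain ⟨⟨u', a'⟩, ha'⟩ := t
  obtain rfl : u = u' := hu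
  simp only at hj
  have hb : (u, a ⊓ a') ∈ dualLatP (tildeCone σ Qs) := by
    refine mem_between ha inf_le_left fun i q hq => ?_
    rcases le_total (a i) (a' i) with h | h
    · have : (a ⊓ a') i = a i := by simp [h]
      rw [this]; exact ((mem_tilde_iff σ Qs u a).1 ha).2.2 i q hq
    · have : (a ⊓ a') i = a' i := by simp [h]
      rw [this]; exact ((mem_tilde_iff σ Qs u a').1 ha').2.2 i q hq
  have h1 := descend R hsub hR0 hRi I j hI u _ hb _ a rfl inf_le_left
    (fun i hi => by simp [hj i hi]) ha
  have h2 := descend R hsub hR0 hRi I j hI u _ hb _ a' rfl inf_le_right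
    (fun i hi => by simp [hj i hi]) ha'
  have h3 := I.sub_mem h1 h2
  rw [sub_sub_sub_cancel_right] at h3
  rwa [← chi_of_mem ha, ← chi_of_mem ha']

end Helpers

/-- Proposition 2.4: the kernel of
`ℂ[σ̃^∨ ∩ M̃] → ℂ[σ^∨ ∩ M]` is generated by the regular sequence
`χ^{R+e_i*} − χ^R`, `i = 1, …, k`. -/
theorem kernel_eq_span_and_regular {d k : ℕ}
    (σ : Set (Fin d → ℝ)) (Qs : Fin (k + 1) → Set (Fin d → ℝ))
    (hσrat : IsRatPolyCone σ) (hσsc : IsStronglyConvex σ)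
    (R : Fin d → ℤ) (hR : castd R ∈ dualCone σ)
    (hne : (σ ∩ {n | pr (castd R) n = 1}).Nonempty)
    (hQsrat : ∀ i, IsRatPolyhedron (Qs i))
    (hdec : σ ∩ {n | pr (castd R) n = 1} = ∑ i, Qs i)
    (hrec : ∀ i, recCone (Qs i) = σ ∩ {n | pr (castd R) n = 0})
    (hstar : CondStar (σ ∩ {n | pr (castd R) n = 1}) Qs)
    (hss0 : Qs 0 ⊆ {n | pr (castd R) n = 1})
    (hssi : ∀ i : Fin k, Qs i.succ ⊆ {n | pr (castd R) n = 0}) :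
    RingHom.ker (AddMonoidAlgebra.mapDomainRingHom ℂ (projHom σ Qs)) =
      Ideal.span (Set.range fun i : Fin k =>
        chi (dualLatP (tildeCone σ Qs)) ((R, 0) + (0, Pi.single i 1)) -
          chi (dualLatP (tildeCone σ Qs)) ((R, 0))) ∧
    RingTheory.Sequence.IsRegular (AddMonoidAlgebra ℂ ↥(dualLatP (tildeCone σ Qs)))
      (List.ofFn fun i : Fin k =>
        chi (dualLatP (tildeCone σ Qs)) ((R, 0) + (0, Pi.single i 1)) -
          chi (dualLatP (tildeCone σ Qs)) ((R, 0))) := by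
  have hRpos : ∀ n ∈ σ, 0 ≤ pr (castd R) n := hR
  have hR0 : (R, (0 : Fin k → ℤ)) ∈ dualLatP (tildeCone σ Qs) := by
    rw [mem_tilde_iff]
    refine ⟨hRpos, fun q hq => ?_, fun i q hq => ?_⟩
    · have h2 : pr (castd R) q = 1 := hss0 hq
      simp [h2]
    · have h2 : pr (castd R) q = 0 := hssi i hq
      simp [h2]
  have hRi : ∀ i : Fin k,
      (R, (0 : Fin k → ℤ)) + (0, Pi.single i 1) ∈ dualLatP (tildeCone σ Qs) := by
    intro i
    rw [Prod.mk_add_mk, add_zero, zero_add, mem_tilde_iff]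
    refine ⟨hRpos, fun q hq => ?_, fun l q hq => ?_⟩
    · have h2 : pr (castd R) q = 1 := hss0 hq
      simp [h2, Pi.single_apply]
    · have h2 : pr (castd R) q = 0 := hssi l hq
      rw [h2, zero_add]
      by_cases hl : l = i
      · subst hl; simp
      · simp [hl]
  have hsub := fun (u : Fin d → ℤ) (a : Fin k → ℤ) (i : Fin k) =>
    mem_sub_R (u := u) (a := a) (i := i) hσrat hR hdec hss0 hssi
  set f : Fin k → AddMonoidAlgebra ℂ ↥(dualLatP (tildeCone σ Qs)) := fun i =>
    chi (dualLatP (tildeCone σ Qs)) ((R, 0) + (0, Pi.single i 1)) -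
          chi (dualLatP (tildeCone σ Qs)) ((R, 0)) with hf
  have hf' : ∀ i, f i = AddMonoidAlgebra.single ⟨_, hRi i⟩ 1 - AddMonoidAlgebra.single ⟨_, hR0⟩ 1 := by
    intro i
    rw [← chi_of_mem (hRi i), ← chi_of_mem hR0]
  have hker : RingHom.ker (AddMonoidAlgebra.mapDomainRingHom ℂ (projHom σ Qs)) =
      Ideal.span (Set.range f) := by
    apply le_antisymm
    · refine ker_mapDomain_le _ _ fun s t hst => ?_
      refine exp_diff_mem R hsub hR0 hRi _ k
        (fun i _ => Ideal.subset_span (Set.mem_range_self (f := f) i)) s t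
        (congrArg Subtype.val hst) (fun i hi => absurd i.2 hi)
    · rw [Ideal.span_le]
      rintro _ ⟨i, rfl⟩
      rw [SetLike.mem_coe, RingHom.mem_ker, hf' i, map_sub]
      simp only [AddMonoidAlgebra.mapDomainRingHom_apply, AddMonoidAlgebra.mapDomain_single]
      rw [sub_eq_zero]
      congr 1
      ext l
      simp [projHom]
  have hkerj : ∀ j : ℕ, RingHom.ker (AddMonoidAlgebra.mapDomainRingHom ℂ
      (forgetHom (dualLatP (tildeCone σ Qs)) j)) = Ideal.ofList ((List.ofFn f).take j) := by
    intro j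
    apply le_antisymm
    · refine ker_mapDomain_le _ _ fun s t hst => ?_
      have h1 := (Prod.ext_iff.1 hst)
      refine exp_diff_mem R hsub hR0 hRi _ j (fun i hi => ?_) s t h1.1 (fun i hi => ?_)
      · refine Ideal.subset_span ?_
        rw [Set.mem_setOf_eq, List.mem_take_iff_getElem]
        exact ⟨i, by simp [hi], by simp [hf]⟩
      · have h2 := congrFun h1.2 i
        simpa [forgetHom, hi] using h2
    · rw [Ideal.ofList, Ideal.span_le]
      intro x hx
      rw [Set.mem_setOf_eq, List.mem_take_iff_getElem] at hx
      obtain ⟨i, hi, rfl⟩ := hx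
      have hi' : i < j ∧ i < k := by simpa using hi
      rw [List.getElem_ofFn, SetLike.mem_coe, RingHom.mem_ker, hf', map_sub]
      simp only [AddMonoidAlgebra.mapDomainRingHom_apply, AddMonoidAlgebra.mapDomain_single]
      rw [sub_eq_zero]
      congr 1
      ext l
      · simp [forgetHom]
      · by_cases hl : (l : ℕ) < j
        · simp [forgetHom, hl]
        · have : l ≠ ⟨i, hi'.2⟩ := by rintro rfl; exact hl hi'.1
          simp [forgetHom, this]
  refine ⟨hker, ⟨⟨fun i hi => ?_⟩, ?_⟩⟩
  · rw [isSMulRegular_quotient_iff_mem_of_smul_mem]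
    intro x hx
    rw [smul_eq_mul, Ideal.mul_top] at *
    rw [← hkerj] at hx ⊢
    rw [RingHom.mem_ker, smul_eq_mul, map_mul] at hx
    refine (mul_eq_zero.1 hx).resolve_left ?_
    have hi' : i < k := by simpa using hi
    rw [List.getElem_ofFn, hf', map_sub]
    simp only [AddMonoidAlgebra.mapDomainRingHom_apply, AddMonoidAlgebra.mapDomain_single]
    intro h
    rw [sub_eq_zero] at h
    have h1 := AddMonoidAlgebra.single_left_injective (one_ne_zero) h
    have h2 := congrFun (Prod.ext_iff.1 h1).2 ⟨i, hi'⟩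
    simp [forgetHom] at h2
  · rw [smul_eq_mul, Ideal.mul_top]
    have h1 := hkerj k
    rw [List.take_of_length_le (by simp)] at h1
    rw [← h1]
    exact (RingHom.ker_ne_top _).symm
end
end

section
/- Let σ ⊆ N_ℝ be a strongly convex rational polyhedral cone, Q ⊆ σ a rational polyhedron with 0 ∉ Q, Q = Q_0 + Q_1 + ⋯ + Q_k a Minkowski sum decomposition into rational polyhedra, and σ̃ the associated cone. Let r, s ∈ σ̃^∨ ∩ M̃ with r − s ∈ ⊕_{i=1}^k ℤe_i*, and write r − s = ∑_{i=1}^k α_i^+ e_i* − ∑_{i=1}^k α_i^− e_i* with α_i^+, α_i^− ∈ ℤ_{≥0} and α_i^+ · α_i^− = 0 for each i. Then q := r − ∑_{i=1}^k α_i^+ e_i* = s − ∑_{i=1}^k α_i^− e_i* lies in σ̃^∨ ∩ M̃. -/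
open Pointwise

noncomputable section

/-- if `r, s ∈ σ̃^∨ ∩ M̃` with `r − s ∈ ⊕ ℤe_i*`, written
`r − s = ∑ α_i⁺ e_i* − ∑ α_i⁻ e_i*` with `α_i⁺·α_i⁻ = 0`, then
`q = r − ∑ α_i⁺ e_i* = s − ∑ α_i⁻ e_i*` also lies in `σ̃^∨ ∩ M̃`. -/
theorem q_mem_dual {d k : ℕ}
    (σ Q : Set (Fin d → ℝ)) (Qs : Fin (k + 1) → Set (Fin d → ℝ))
    (hσrat : IsRatPolyCone σ) (hσsc : IsStronglyConvex σ)
    (hQrat : IsRatPolyhedron Q) (hQσ : Q ⊆ σ) (hQ0 : (0 : Fin d → ℝ) ∉ Q)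
    (hQsrat : ∀ i, IsRatPolyhedron (Qs i))
    (hdec : Q = ∑ i, Qs i)
    (hrec : ∀ i i', recCone (Qs i) = recCone (Qs i'))
    (r s : (Fin d → ℤ) × (Fin k → ℤ))
    (hr : castP r ∈ dualConeP (tildeCone σ Qs))
    (hs : castP s ∈ dualConeP (tildeCone σ Qs))
    (hfirst : r.1 = s.1)
    (αp αm : Fin k → ℤ)
    (hαp : ∀ i, 0 ≤ αp i) (hαm : ∀ i, 0 ≤ αm i)
    (hdisj : ∀ i, αp i * αm i = 0)
    (hα : ∀ i, r.2 i - s.2 i = αp i - αm i) :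
    castP (r.1, fun i => r.2 i - αp i) ∈ dualConeP (tildeCone σ Qs) := by
  have gen : ∀ u : (Fin d → ℝ) × (Fin k → ℝ), u ∈ dualConeP (tildeCone σ Qs) →
      ∀ g ∈ tildeGen σ Qs, 0 ≤ prP u g := by
    intro u hu g hg
    exact hu g ⟨1, fun _ => 1, fun _ => g, by simp, by simpa using hg, by simp⟩
  have hr' := gen _ hr
  have hs' := gen _ hs
  have key : ∀ g ∈ tildeGen σ Qs,
      0 ≤ prP (castP (r.1, fun i => r.2 i - αp i)) g := by
    intro g hg
    have h1 := hr' g hg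
    have h2 := hs' g hg
    rcases hg with (⟨n, hn, rfl⟩ | ⟨n, hn, rfl⟩) | hg
    · simpa [prP, castP, pr] using h1
    · have h3 : (0 : ℝ) ≤ ∑ i, (αp i : ℝ) :=
        Finset.sum_nonneg fun i _ => by exact_mod_cast hαp i
      simp [prP, castP, pr, castd, Finset.sum_sub_distrib] at h1 ⊢
      linarith
    · obtain ⟨i, hi⟩ := Set.mem_iUnion.mp hg
      obtain ⟨n, hn, rfl⟩ := hi
      have h4 : (r.2 i : ℝ) - s.2 i = αp i - αm i := by exact_mod_cast hα i
      simp [prP, castP, pr, castd, Pi.single_apply] at h1 h2 ⊢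
      rw [← hfirst] at h2
      rcases mul_eq_zero.mp (hdisj i) with h | h
      · rw [h]
        simpa using h1
      · rw [h] at h4
        push_cast at h4
        linarith
  rintro n ⟨m, c, v, hc, hv, rfl⟩
  have hlin : ∀ u : (Fin d → ℝ) × (Fin k → ℝ),
      prP u (∑ i, c i • v i) = ∑ i, c i * prP u (v i) := by
    intro u
    simp only [prP, pr, Prod.fst_sum, Prod.snd_sum, Finset.sum_apply, Prod.smul_fst,
      Prod.smul_snd, Pi.smul_apply, smul_eq_mul, Finset.mul_sum, mul_add,
      Finset.sum_add_distrib]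
    congr 1
    · rw [Finset.sum_comm]
      exact Finset.sum_congr rfl fun i _ => Finset.sum_congr rfl fun j _ => by ring
    · rw [Finset.sum_comm]
      exact Finset.sum_congr rfl fun i _ => Finset.sum_congr rfl fun j _ => by ring
  rw [hlin]
  exact Finset.sum_nonneg fun i _ => mul_nonneg (hc i) (key _ (hv i))
end
end

section
/- Let A be a k × n matrix with real entries whose column index set is partitioned into nonempty sets B_0, B_1, …, B_k and a (possibly empty) set B′, such that for each row i ∈ {1,…,k}: the entries of row i in the columns of B_0 are all negative, the entries of row i in the columns of B_i are all positive, and all other entries of row i are zero. Then A is mixed dominating: every row of A contains both a positive and a negative entry, and A contains no square submatrix (obtained by selecting an equal number of rows and columns) each of whose rows contains both a positive and a negative entry. -/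
/-- A matrix is mixed if every row contains both a positive and a negative entry. -/
def Matrix.IsMixed {p q : ℕ} (A : Matrix (Fin p) (Fin q) ℝ) : Prop :=
  ∀ i, (∃ j, 0 < A i j) ∧ (∃ j, A i j < 0)

/-- A matrix is dominating if it contains no (nonempty) square mixed submatrix. -/
def Matrix.IsDominating {p q : ℕ} (A : Matrix (Fin p) (Fin q) ℝ) : Prop :=
  ∀ (m : ℕ), 0 < m → ∀ (r : Fin m → Fin p) (c : Fin m → Fin q),
    Function.Injective r → Function.Injective c → ¬ (A.submatrix r c).IsMixed

/-- a `k × n` matrix whose columns are partitioned into nonempty blocks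
`B₀, B₁, …, B_k` (and a possibly empty remainder) such that row `i` is negative on `B₀`,
positive on `B_i`, and zero elsewhere, is mixed dominating. -/
theorem block_matrix_mixed_dominating {k n : ℕ}
    (A : Matrix (Fin k) (Fin n) ℝ) (B : Fin (k + 1) → Finset (Fin n))
    (hdisj : ∀ i i', i ≠ i' → Disjoint (B i) (B i'))
    (hne : ∀ i, (B i).Nonempty)
    (hneg : ∀ i : Fin k, ∀ j ∈ B 0, A i j < 0)
    (hpos : ∀ i : Fin k, ∀ j ∈ B i.succ, 0 < A i j)
    (hzero : ∀ i : Fin k, ∀ j : Fin n, j ∉ B 0 → j ∉ B i.succ → A i j = 0) :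
    A.IsMixed ∧ A.IsDominating := by
  refine ⟨fun i => ⟨?_, ?_⟩, ?_⟩
  · obtain ⟨j, hj⟩ := hne i.succ
    exact ⟨j, hpos i j hj⟩
  · obtain ⟨j, hj⟩ := hne 0
    exact ⟨j, hneg i j hj⟩
  · intro m hm r c hr hc hmix
    choose f hf using fun i => (hmix i).1
    have hB0 : ∀ i, c (f i) ∉ B 0 := fun i h => by
      have h1 := hneg (r i) _ h
      have h2 := hf i
      simp only [Matrix.submatrix_apply] at h2
      linarith
    have hB : ∀ i, c (f i) ∈ B (r i).succ := fun i => by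
      by_contra h
      have h1 := hzero (r i) _ (hB0 i) h
      have h2 := hf i
      simp only [Matrix.submatrix_apply] at h2
      linarith
    have hinj : Function.Injective f := by
      intro a b hab
      by_contra hne'
      have hd := hdisj (r a).succ (r b).succ
        (fun h => hne' (hr (Fin.succ_injective _ h)))
      have hb := hB b
      rw [← hab] at hb
      exact Finset.disjoint_left.mp hd (hB a) hb
    have hsurj : Function.Surjective f := Finite.surjective_of_injective hinj
    obtain ⟨j, hj⟩ := (hmix ⟨0, hm⟩).2
    obtain ⟨i, rfl⟩ := hsurj j
    simp only [Matrix.submatrix_apply] at hj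
    by_cases h : c (f i) ∈ B (r ⟨0, hm⟩).succ
    · have := hpos _ _ h
      linarith
    · have := hzero _ _ (hB0 i) h
      linarith
end

section
/- Let P_1, …, P_n be polytopes in ℝ^d and let r_1, …, r_n be an affine basis of ℝ^{n−1}. If ℬ is a polyhedral subdivision of the Cayley polytope 𝒞(P_1, …, P_n) all of whose 0-dimensional cells (vertices of cells of ℬ) are contained in (P_1 × {r_1}) ∪ ⋯ ∪ (P_n × {r_n}), then the intersections of the cells of ℬ with the affine subspace ℝ^d × {(1/n)(r_1 + ⋯ + r_n)} form a mixed subdivision of (1/n)(P_1 + ⋯ + P_n). -/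
open Pointwise

noncomputable section

/-- A polytope: the convex hull of a finite set of points. -/
def IsPolytope {E : Type*} [AddCommGroup E] [Module ℝ E] (P : Set E) : Prop :=
  ∃ s : Finset E, P = convexHull ℝ (s : Set E)

/-- A polyhedral subdivision of a set `S` with the given collection of cells:
finitely many polytopes covering `S`, any two of which intersect in a common
(exposed, possibly empty) face of each. -/
def IsPolySubdivision {E : Type*} [NormedAddCommGroup E] [NormedSpace ℝ E]
    (S : Set E) (cells : Set (Set E)) : Prop :=
  cells.Finite ∧ (∀ C ∈ cells, IsPolytope C) ∧ ⋃₀ cells = S ∧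
    ∀ C ∈ cells, ∀ C' ∈ cells,
      IsExposed ℝ C (C ∩ C') ∧ IsExposed ℝ C' (C ∩ C')

/-- A mixed subdivision of `P₁ + ⋯ + Pₙ`: a polyhedral subdivision of the Minkowski
sum together with a Minkowski sum decomposition `Q = Q₁ + ⋯ + Qₙ` of each cell with
`Qᵢ ⊆ Pᵢ`, such that for any two cells the `i`-th summands intersect in a common face. -/
def MixedSubdivision {E : Type*} [NormedAddCommGroup E] [NormedSpace ℝ E] (n : ℕ)
    (Ps : Fin n → Set E) (cells : Set (Set E)) (D : Set E → Fin n → Set E) : Prop :=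
  IsPolySubdivision (∑ i, Ps i) cells ∧
    (∀ Q ∈ cells, Q = ∑ i, D Q i ∧ ∀ i, IsPolytope (D Q i) ∧ D Q i ⊆ Ps i) ∧
    ∀ Q ∈ cells, ∀ Q' ∈ cells, ∀ i,
      IsExposed ℝ (D Q i) (D Q i ∩ D Q' i) ∧ IsExposed ℝ (D Q' i) (D Q i ∩ D Q' i)

/-- The Cayley embedding polytope `𝒞(Q₁, …, Qₙ) = Conv(⋃ᵢ Qᵢ × {rᵢ})`. -/
def cayley {d n m : ℕ} (r : Fin n → (Fin m → ℝ)) (Qs : Fin n → Set (Fin d → ℝ)) :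
    Set ((Fin d → ℝ) × (Fin m → ℝ)) :=
  convexHull ℝ (⋃ i, (fun q => (q, r i)) '' Qs i)

/-- Preimages of exposed faces under `x ↦ (t • x, a)` are exposed. -/
theorem isExposed_slice {E F : Type*} [NormedAddCommGroup E] [NormedSpace ℝ E]
    [NormedAddCommGroup F] [NormedSpace ℝ F] {A B : Set (E × F)} (h : IsExposed ℝ A B)
    (t : ℝ) (a : F) :
    IsExposed ℝ {x : E | (t • x, a) ∈ A} {x : E | (t • x, a) ∈ B} := by
  rintro ⟨x0, hx0⟩
  obtain ⟨l, hl⟩ := h ⟨_, hx0⟩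
  have key : ∀ x : E, l (t • x, a) = (t • l.comp (ContinuousLinearMap.inl ℝ E F)) x + l (0, a) := by
    intro x
    have : ((t • x, a) : E × F) = t • (x, (0 : F)) + (0, a) := by simp
    rw [this, map_add, map_smul]
    simp
  refine ⟨t • l.comp (ContinuousLinearMap.inl ℝ E F), ?_⟩
  ext x
  simp only [Set.mem_ofPred_eq] at hx0 ⊢
  rw [hl] at hx0 ⊢
  constructor
  · rintro ⟨h1, h2⟩
    refine ⟨h1, fun y hy => ?_⟩
    have := h2 _ hy
    rw [key, key] at this
    linarith
  · rintro ⟨h1, h2⟩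
    refine ⟨h1, fun y hy => ?_⟩
    have h3 := h2 x0 hx0.1
    have h4 := hx0.2 y hy
    rw [key] at h4 ⊢
    linarith

/-- Decomposition of points of the Cayley polytope along the barycentric coordinates. -/
theorem cayley_decomp {d n m : ℕ} {r : Fin n → (Fin m → ℝ)} (hr : AffineIndependent ℝ r)
    (Qs : Fin n → Set (Fin d → ℝ)) (u : Fin n → ℝ) (hu : ∑ i, u i = 1) (x : Fin d → ℝ)
    (hx : (x, ∑ i, u i • r i) ∈ cayley r Qs) :
    ∃ p : Fin n → (Fin d → ℝ), ∑ i, p i = x ∧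
      ∀ i, (u i = 0 → p i = 0) ∧ (0 < u i → (u i)⁻¹ • p i ∈ convexHull ℝ (Qs i)) := by
  classical
  unfold cayley at hx
  rw [_root_.convexHull_eq] at hx
  obtain ⟨ι, t, w, z, hw0, hw1, hz, hc⟩ := hx
  rw [Finset.centerMass_eq_of_sum_1 _ _ hw1] at hc
  have hz' : ∀ j : ι, ∃ i : Fin n, j ∈ t → (z j).1 ∈ Qs i ∧ (z j).2 = r i := by
    intro j
    by_cases hj : j ∈ t
    · obtain ⟨i, q, hq, he⟩ := Set.mem_iUnion.1 (hz j hj)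
      refine ⟨i, fun _ => ?_⟩
      rw [← he]
      exact ⟨hq, rfl⟩
    · have hne : t.Nonempty := by
        rw [Finset.nonempty_iff_ne_empty]
        rintro rfl
        simp at hw1
      obtain ⟨k, hk⟩ := hne
      obtain ⟨i, _⟩ := Set.mem_iUnion.1 (hz k hk)
      exact ⟨i, fun h => absurd h hj⟩
  choose c hcc using hz'
  set v : Fin n → ℝ := fun i => ∑ j ∈ t with c j = i, w j with hv
  have hv1 : ∑ i, v i = 1 := by
    rw [← hw1]
    exact Finset.sum_fiberwise t c w
  have h1 : ∑ j ∈ t, w j • (z j).1 = x := by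
    have := congrArg Prod.fst hc
    simpa [Prod.fst_sum] using this
  have h2 : ∑ j ∈ t, w j • (z j).2 = ∑ i, u i • r i := by
    have := congrArg Prod.snd hc
    simpa [Prod.snd_sum] using this
  have h3 : ∑ i, v i • r i = ∑ i, u i • r i := by
    rw [← h2, ← Finset.sum_fiberwise t c (fun j => w j • (z j).2)]
    refine Finset.sum_congr rfl fun i _ => ?_
    rw [hv, Finset.sum_smul]
    refine Finset.sum_congr rfl fun j hj => ?_
    obtain ⟨hjt, rfl⟩ := Finset.mem_filter.1 hj
    rw [(hcc j hjt).2]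
  have hvu : v = u := by
    have := (affineIndependent_iff_eq_of_fintype_affineCombination_eq ℝ r).1 hr v u hv1 hu
    apply this
    rw [Finset.affineCombination_eq_linear_combination _ _ _ hv1,
      Finset.affineCombination_eq_linear_combination _ _ _ hu, h3]
  refine ⟨fun i => ∑ j ∈ t with c j = i, w j • (z j).1, ?_, fun i => ⟨?_, ?_⟩⟩
  · rw [← h1]
    exact Finset.sum_fiberwise t c _
  · intro hi
    rw [← hvu] at hi
    refine Finset.sum_eq_zero fun j hj => ?_
    have := (Finset.sum_eq_zero_iff_of_nonneg
      (fun j hj => hw0 j (Finset.mem_filter.1 hj).1)).1 hi j hj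
    rw [this, zero_smul]
  · intro hi
    rw [← hvu] at hi ⊢
    refine Finset.centerMass_mem_convexHull (t.filter fun j => c j = i)
      (fun j hj => hw0 j (Finset.mem_filter.1 hj).1) hi (fun j hj => ?_)
    obtain ⟨hjt, rfl⟩ := Finset.mem_filter.1 hj
    exact (hcc j hjt).1

theorem cayley_comp {d n m : ℕ} (r : Fin n → (Fin m → ℝ))
    (Qs : Fin n → Set (Fin d → ℝ)) (i : Fin n) (x : Fin d → ℝ)
    (hx : x ∈ convexHull ℝ (Qs i)) : (x, r i) ∈ cayley r Qs := by
  have h : (x, r i) ∈ (convexHull ℝ (Qs i)) ×ˢ (convexHull ℝ ({r i} : Set (Fin m → ℝ))) :=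
    ⟨hx, by simp⟩
  rw [← convexHull_prod] at h
  refine convexHull_mono ?_ h
  rintro ⟨a, b⟩ ⟨ha, hb⟩
  simp only [Set.mem_singleton_iff] at hb
  exact Set.mem_iUnion.2 ⟨i, a, ha, by rw [← hb]⟩

theorem cayley_vertex_slice {d n m : ℕ} {r : Fin n → (Fin m → ℝ)} (hr : AffineIndependent ℝ r)
    (Qs : Fin n → Set (Fin d → ℝ)) (i : Fin n) (x : Fin d → ℝ) :
    (x, r i) ∈ cayley r Qs ↔ x ∈ convexHull ℝ (Qs i) := by
  classical
  refine ⟨fun h => ?_, cayley_comp r Qs i x⟩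
  have e : r i = ∑ j, (Pi.single i (1 : ℝ) : Fin n → ℝ) j • r j := by
    simp [Pi.single_apply]
  rw [e] at h
  obtain ⟨p, hp, hpi⟩ := cayley_decomp hr Qs _ (by simp) x h
  have hx : p i = x := by
    rw [← hp]
    refine (Finset.sum_eq_single i (fun j _ hj => (hpi j).1 (by simp [hj])) (by simp)).symm
  have := (hpi i).2 (by simp)
  simpa [hx] using this

theorem cayley_mid_slice {d n m : ℕ} (hn : 0 < n) {r : Fin n → (Fin m → ℝ)}
    (hr : AffineIndependent ℝ r) (Qs : Fin n → Set (Fin d → ℝ)) :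
    {x : Fin d → ℝ | (x, (n : ℝ)⁻¹ • ∑ i, r i) ∈ cayley r Qs} =
      ∑ i, (n : ℝ)⁻¹ • convexHull ℝ (Qs i) := by
  have hn' : (0 : ℝ) < n := by exact_mod_cast hn
  have hsum : ∑ _i : Fin n, (n : ℝ)⁻¹ = 1 := by
    simp [hn'.ne']
  ext x
  rw [Set.mem_fintype_sum, Set.mem_ofPred_eq, Finset.smul_sum]
  constructor
  · intro h
    obtain ⟨p, hp, hpi⟩ := cayley_decomp hr Qs (fun _ => (n : ℝ)⁻¹) hsum x h
    refine ⟨p, fun i => ?_, hp⟩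
    rw [Set.mem_smul_set_iff_inv_smul_mem₀ (inv_ne_zero hn'.ne')]
    exact (hpi i).2 (inv_pos.2 hn')
  · rintro ⟨g, hg, rfl⟩
    choose q hq hqg using fun i => Set.mem_smul_set.1 (hg i)
    have := (convex_convexHull ℝ (⋃ i, (fun q => (q, r i)) '' Qs i)).sum_mem
      (t := Finset.univ) (w := fun _ => (n : ℝ)⁻¹) (z := fun i => (q i, r i))
      (fun _ _ => (inv_pos.2 hn').le) hsum (fun i _ => cayley_comp r Qs i _ (hq i))
    have e : ∑ i, (n : ℝ)⁻¹ • (q i, r i) = (∑ i, g i, ∑ i, (n : ℝ)⁻¹ • r i) := by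
      ext1
      · simp [Prod.fst_sum, hqg]
      · simp [Prod.snd_sum]
    rw [e] at this
    exact this

theorem isPolytope_of_finite {E : Type*} [AddCommGroup E] [Module ℝ E] {s : Set E}
    (hs : s.Finite) : IsPolytope (convexHull ℝ s) :=
  ⟨hs.toFinset, by simp⟩

theorem cell_eq_cayley {d n m : ℕ} (r : Fin n → (Fin m → ℝ)) (Ps : Fin n → Set (Fin d → ℝ))
    (B : Set ((Fin d → ℝ) × (Fin m → ℝ))) (hB : IsPolytope B)
    (hv : ∀ v ∈ B.extremePoints ℝ, ∃ i, v ∈ (fun q => (q, r i)) '' Ps i) :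
    ∃ Vs : Fin n → Set (Fin d → ℝ), (∀ i, (Vs i).Finite ∧ Vs i ⊆ Ps i) ∧
      B = cayley r Vs := by
  obtain ⟨s, rfl⟩ := hB
  have hfin : ((convexHull ℝ (s : Set ((Fin d → ℝ) × (Fin m → ℝ)))).extremePoints ℝ).Finite :=
    s.finite_toSet.subset extremePoints_convexHull_subset
  have hkm := closure_convexHull_extremePoints
    (s.finite_toSet.isCompact_convexHull ℝ)
    (convex_convexHull ℝ _)
  rw [(hfin.isClosed_convexHull ℝ).closure_eq] at hkm
  set V := (convexHull ℝ (s : Set ((Fin d → ℝ) × (Fin m → ℝ)))).extremePoints ℝ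
  refine ⟨fun i => {q | q ∈ Ps i ∧ (q, r i) ∈ V}, fun i => ⟨?_, fun q hq => hq.1⟩, ?_⟩
  · exact (hfin.image Prod.fst).subset fun q hq => ⟨_, hq.2, rfl⟩
  · rw [← hkm]
    unfold cayley
    congr 1
    ext v
    simp only [Set.mem_iUnion]
    constructor
    · intro h
      obtain ⟨i, q, hq, rfl⟩ := hv v h
      exact ⟨i, q, ⟨hq, h⟩, rfl⟩
    · rintro ⟨i, q, hq, rfl⟩
      exact hq.2

/-- Theorem 3.4 (ii): slicing a polyhedral subdivision of the Cayley
polytope whose vertices lie in `⋃ᵢ Pᵢ × {rᵢ}` by the affine subspace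
`ℝ^d × {(1/n)∑ᵢ rᵢ}` yields a mixed subdivision of `(1/n)(P₁ + ⋯ + Pₙ)`. -/
theorem slice_of_cayley_subdivision_is_mixed {d n : ℕ} (hn : 0 < n)
    (r : Fin n → (Fin (n - 1) → ℝ))
    (hr : AffineIndependent ℝ r ∧ affineSpan ℝ (Set.range r) = ⊤)
    (Ps : Fin n → Set (Fin d → ℝ)) (hPs : ∀ i, IsPolytope (Ps i))
    (ℬ : Set (Set ((Fin d → ℝ) × (Fin (n - 1) → ℝ))))
    (hsub : IsPolySubdivision (cayley r Ps) ℬ)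
    (hvert : ∀ B ∈ ℬ, ∀ v ∈ B.extremePoints ℝ, ∃ i, v ∈ (fun q => (q, r i)) '' Ps i) :
    ∃ D : Set (Fin d → ℝ) → Fin n → Set (Fin d → ℝ),
      MixedSubdivision n (fun i => (n : ℝ)⁻¹ • Ps i)
        ((fun B => {x : Fin d → ℝ | (x, (n : ℝ)⁻¹ • ∑ i, r i) ∈ B}) '' ℬ) D := by
  classical
  have hn' : (n : ℝ) ≠ 0 := by exact_mod_cast hn.ne'
  obtain ⟨hfin, hpoly, hcov, hface⟩ := hsub
  have hcell := fun B hB => cell_eq_cayley r Ps B (hpoly B hB) (hvert B hB)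
  have hconv : ∀ i, convexHull ℝ (Ps i) = Ps i := by
    intro i
    obtain ⟨s, hs⟩ := hPs i
    rw [hs]
    exact (convex_convexHull ℝ _).convexHull_eq
  set c : Fin (n - 1) → ℝ := (n : ℝ)⁻¹ • ∑ i, r i with hc
  set S : Set ((Fin d → ℝ) × (Fin (n - 1) → ℝ)) → Set (Fin d → ℝ) :=
    fun B => {x : Fin d → ℝ | (x, c) ∈ B} with hS
  have hrep : ∀ Q : Set (Fin d → ℝ), ∃ B, Q ∈ S '' ℬ → B ∈ ℬ ∧ S B = Q := by
    intro Q
    by_cases h : Q ∈ S '' ℬ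
    · obtain ⟨B, hB⟩ := h
      exact ⟨B, fun _ => hB⟩
    · exact ⟨∅, fun h' => absurd h' h⟩
  choose R hR using hrep
  have hmem : ∀ (Vs : Fin n → Set (Fin d → ℝ)) (i : Fin n),
      {x : Fin d → ℝ | ((n : ℝ) • x, r i) ∈ cayley r Vs} = (n : ℝ)⁻¹ • convexHull ℝ (Vs i) := by
    intro Vs i
    ext x
    rw [Set.mem_ofPred_eq, cayley_vertex_slice hr.1,
      Set.mem_smul_set_iff_inv_smul_mem₀ (inv_ne_zero hn'), inv_inv]
  have hfaceS : ∀ A B : Set ((Fin d → ℝ) × (Fin (n - 1) → ℝ)), IsExposed ℝ A B →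
      IsExposed ℝ (S A) (S B) := by
    intro A B h
    have := isExposed_slice h 1 c
    simpa only [one_smul] using this
  refine ⟨fun Q i => {x | ((n : ℝ) • x, r i) ∈ R Q}, ⟨hfin.image _, ?_, ?_, ?_⟩, ?_, ?_⟩
  · rintro _ ⟨B, hB, rfl⟩
    obtain ⟨Vs, hVs, rfl⟩ := hcell B hB
    have h : S (cayley r Vs) = convexHull ℝ (∑ i, (n : ℝ)⁻¹ • Vs i) := by
      rw [convexHull_sum]
      simp only [convexHull_smul]
      exact cayley_mid_slice hn hr.1 Vs
    rw [h]
    refine isPolytope_of_finite ?_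
    have hf : ∀ i, ((n : ℝ)⁻¹ • Vs i).Finite := fun i => (hVs i).1.smul_set
    refine Set.Finite.subset ((Set.Finite.pi' hf).image fun g => ∑ i, g i) ?_
    intro x hx
    obtain ⟨g, hg, hgx⟩ := (Set.mem_fintype_sum _ _).1 hx
    exact ⟨g, fun i => hg i, hgx⟩
  · have h := cayley_mid_slice hn hr.1 Ps
    simp only [hconv] at h
    rw [← h, ← hcov]
    ext x
    simp only [Set.mem_sUnion, Set.mem_image, hS, Set.mem_ofPred_eq]
    constructor
    · rintro ⟨_, ⟨B, hB, rfl⟩, hx⟩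
      exact ⟨B, hB, hx⟩
    · rintro ⟨B, hB, hx⟩
      exact ⟨_, ⟨B, hB, rfl⟩, hx⟩
  · rintro _ ⟨B, hB, rfl⟩ _ ⟨B', hB', rfl⟩
    exact ⟨hfaceS _ _ (hface B hB B' hB').1, hfaceS _ _ (hface B hB B' hB').2⟩
  · intro Q hQ
    obtain ⟨hB, hBQ⟩ := hR Q hQ
    obtain ⟨Vs, hVs, he⟩ := hcell _ hB
    have hD : ∀ i, {x : Fin d → ℝ | ((n : ℝ) • x, r i) ∈ R Q} =
        (n : ℝ)⁻¹ • convexHull ℝ (Vs i) := by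
      intro i
      rw [he]
      exact hmem Vs i
    simp only [hD]
    refine ⟨?_, fun i => ⟨?_, ?_⟩⟩
    · rw [← hBQ, he]
      exact cayley_mid_slice hn hr.1 Vs
    · rw [← convexHull_smul]
      exact isPolytope_of_finite (hVs i).1.smul_set
    · refine Set.smul_set_mono ?_
      rw [← hconv i]
      exact convexHull_mono (hVs i).2
  · intro Q hQ Q' hQ' i
    have := hface _ (hR Q hQ).1 _ (hR Q' hQ').1
    exact ⟨isExposed_slice this.1 n (r i), isExposed_slice this.2 n (r i)⟩
end
end

section
/- Let k ≥ 1 and let b_0, b_1, …, b_k and c_0, c_1, …, c_k be real numbers with b_i ≥ c_i for all i, B := ∑_{i=0}^k b_i > 0, and C := ∑_{i=0}^k c_i < 0. Define a_i = (C·b_i − B·c_i)/(B − C) for i = 1, …, k. Then −c_i ≥ a_i ≥ −b_i for each i = 1,…,k, with both inequalities strict whenever b_i > c_i; and b_0 ≥ ∑_{i=1}^k a_i ≥ c_0, with both inequalities strict whenever b_0 > c_0. -/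
theorem interp_aux {B C x y : ℝ} (hB : 0 < B) (hC : C < 0) (h : y ≤ x) :
    -y ≥ (C * x - B * y) / (B - C) ∧ (C * x - B * y) / (B - C) ≥ -x ∧
    (y < x → -y > (C * x - B * y) / (B - C) ∧ (C * x - B * y) / (B - C) > -x) := by
  have hD : 0 < B - C := by linarith
  refine ⟨?_, ?_, fun h' => ⟨?_, ?_⟩⟩
  · rw [ge_iff_le, div_le_iff₀ hD]; nlinarith
  · rw [ge_iff_le, le_div_iff₀ hD]; nlinarith
  · rw [gt_iff_lt, div_lt_iff₀ hD]; nlinarith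
  · rw [gt_iff_lt, lt_div_iff₀ hD]; nlinarith

/-- from the proof of Lemma 4.4: the interpolation coefficients
`a_i = (C·b_i − B·c_i)/(B − C)` satisfy `−c_i ≥ a_i ≥ −b_i` and
`b₀ ≥ ∑ a_i ≥ c₀`, strictly where `b_i > c_i` (resp. `b₀ > c₀`). -/
theorem interpolation_coefficients {k : ℕ} (hk : 1 ≤ k)
    (b c : Fin (k + 1) → ℝ)
    (hbc : ∀ i, c i ≤ b i)
    (hB : 0 < ∑ i, b i)
    (hC : ∑ i, c i < 0) :
    (∀ i : Fin k,
      -c i.succ ≥ ((∑ j, c j) * b i.succ - (∑ j, b j) * c i.succ) / ((∑ j, b j) - ∑ j, c j) ∧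
      ((∑ j, c j) * b i.succ - (∑ j, b j) * c i.succ) / ((∑ j, b j) - ∑ j, c j) ≥ -b i.succ ∧
      (c i.succ < b i.succ →
        -c i.succ > ((∑ j, c j) * b i.succ - (∑ j, b j) * c i.succ) / ((∑ j, b j) - ∑ j, c j) ∧
        ((∑ j, c j) * b i.succ - (∑ j, b j) * c i.succ) / ((∑ j, b j) - ∑ j, c j) > -b i.succ)) ∧
    (b 0 ≥ ∑ i : Fin k,
        ((∑ j, c j) * b i.succ - (∑ j, b j) * c i.succ) / ((∑ j, b j) - ∑ j, c j) ∧
      (∑ i : Fin k,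
        ((∑ j, c j) * b i.succ - (∑ j, b j) * c i.succ) / ((∑ j, b j) - ∑ j, c j)) ≥ c 0 ∧
      (c 0 < b 0 →
        b 0 > ∑ i : Fin k,
            ((∑ j, c j) * b i.succ - (∑ j, b j) * c i.succ) / ((∑ j, b j) - ∑ j, c j) ∧
          (∑ i : Fin k,
            ((∑ j, c j) * b i.succ - (∑ j, b j) * c i.succ) / ((∑ j, b j) - ∑ j, c j)) > c 0)) := by
  refine ⟨fun i => interp_aux hB hC (hbc _), ?_⟩
  have key : ∑ i : Fin k,
      ((∑ j, c j) * b i.succ - (∑ j, b j) * c i.succ) / ((∑ j, b j) - ∑ j, c j)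
      = -(((∑ j, c j) * b 0 - (∑ j, b j) * c 0) / ((∑ j, b j) - ∑ j, c j)) := by
    rw [← Finset.sum_div, Finset.sum_sub_distrib, ← Finset.mul_sum, ← Finset.mul_sum, ← neg_div]
    congr 1
    rw [Fin.sum_univ_succ b, Fin.sum_univ_succ c]
    ring
  rw [key]
  obtain ⟨h1, h2, h3⟩ := interp_aux hB hC (hbc 0)
  refine ⟨by linarith, by linarith, fun h => ?_⟩
  obtain ⟨h4, h5⟩ := h3 h
  exact ⟨by linarith, by linarith⟩
end

section
/- Let L ⊆ ℤ^n be a saturated sublattice of rank k with L ∩ ℕ^n = {0}, and let l^1, …, l^k be a ℤ-basis of L. Write each l^i = l^i_+ − l^i_− with l^i_+, l^i_− ∈ ℕ^n of disjoint support. If the k × n integer matrix whose rows are l^1, …, l^k is mixed dominating, then in the polynomial ring ℂ[x_1,…,x_n]: (1) the lattice ideal I_L = ⟨x^u − x^v : u, v ∈ ℕ^n, u − v ∈ L⟩ equals the lattice basis ideal I_𝐋 = ⟨x^{l^i_+} − x^{l^i_−} : i = 1,…,k⟩; (2) the sequence x^{l^1_+} − x^{l^1_−}, …, x^{l^k_+}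 − x^{l^k_−} is a regular sequence in ℂ[x_1,…,x_n]; and (3) I_L is a prime ideal. -/
open MvPolynomial

/-- The monomial `x^u = ∏ xᵢ^{uᵢ}` in `ℂ[x₁,…,xₙ]`. -/
noncomputable def xpow {n : ℕ} (u : Fin n → ℕ) : MvPolynomial (Fin n) ℂ :=
  ∏ j, (X j : MvPolynomial (Fin n) ℂ) ^ u j

/-- A matrix over ℤ is mixed if every row has a positive and a negative entry. -/
def IsMixedZ {p q : ℕ} (A : Matrix (Fin p) (Fin q) ℤ) : Prop :=
  ∀ i, (∃ j, 0 < A i j) ∧ (∃ j, A i j < 0)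

/-- A matrix over ℤ is dominating if it has no (nonempty) square mixed submatrix. -/
def IsDominatingZ {p q : ℕ} (A : Matrix (Fin p) (Fin q) ℤ) : Prop :=
  ∀ (m : ℕ), 0 < m → ∀ (r : Fin m → Fin p) (c : Fin m → Fin q),
    Function.Injective r → Function.Injective c → ¬ IsMixedZ (A.submatrix r c)

theorem xpow_eq_monomial {n : ℕ} (u : Fin n → ℕ) :
    xpow u = monomial (Finsupp.equivFunOnFinite.symm u) 1 := by
  rw [monomial_eq, Finsupp.prod_fintype _ _ (by simp)]
  simp [xpow]

theorem xpow_add {n : ℕ} (u v : Fin n → ℕ) : xpow (u + v) = xpow u * xpow v := by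
  simp [xpow, pow_add, Finset.prod_mul_distrib]

/-- The lattice ideal. -/
noncomputable def latIdeal {n : ℕ} (L : AddSubgroup (Fin n → ℤ)) :
    Ideal (MvPolynomial (Fin n) ℂ) :=
  Ideal.span {f : MvPolynomial (Fin n) ℂ | ∃ u v : Fin n → ℕ,
        (fun j => (u j : ℤ) - (v j : ℤ)) ∈ L ∧ f = xpow u - xpow v}

/-- The map to the group algebra of the quotient. -/
noncomputable def latMap {n : ℕ} (L : AddSubgroup (Fin n → ℤ)) :
    MvPolynomial (Fin n) ℂ →ₐ[ℂ] AddMonoidAlgebra ℂ ((Fin n → ℤ) ⧸ L) :=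
  aeval (fun j => AddMonoidAlgebra.of ℂ _
    (Multiplicative.ofAdd (QuotientAddGroup.mk (Pi.single j 1))))

theorem latMap_xpow {n : ℕ} (L : AddSubgroup (Fin n → ℤ)) (u : Fin n → ℕ) :
    latMap L (xpow u) = AddMonoidAlgebra.single
      (QuotientAddGroup.mk (fun j => (u j : ℤ)) : (Fin n → ℤ) ⧸ L) 1 := by
  have h : (fun j => (u j : ℤ)) = ∑ j, u j • (Pi.single j (1 : ℤ) : Fin n → ℤ) := by
    funext j
    simp [Finset.sum_apply, Pi.single_apply]
  have h2 : (QuotientAddGroup.mk (fun j => (u j : ℤ)) : (Fin n → ℤ) ⧸ L)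
      = ∑ j, u j • (QuotientAddGroup.mk (Pi.single j (1 : ℤ)) : (Fin n → ℤ) ⧸ L) := by
    rw [h]
    change QuotientAddGroup.mk' L _ = _
    simp only [map_sum, map_nsmul]
    rfl
  rw [h2]
  rw [show AddMonoidAlgebra.single
    (∑ j, u j • (QuotientAddGroup.mk (Pi.single j (1 : ℤ)) : (Fin n → ℤ) ⧸ L)) (1 : ℂ) =
    AddMonoidAlgebra.of ℂ ((Fin n → ℤ) ⧸ L) (Multiplicative.ofAdd
    (∑ j, u j • (QuotientAddGroup.mk (Pi.single j (1 : ℤ)) : (Fin n → ℤ) ⧸ L))) from rfl]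
  rw [ofAdd_sum, map_prod]
  simp only [latMap, xpow, map_prod, map_pow, aeval_X, ofAdd_nsmul]

theorem mk_eq_iff {n : ℕ} (L : AddSubgroup (Fin n → ℤ)) (u v : Fin n → ℕ) :
    (QuotientAddGroup.mk (fun j => (u j : ℤ)) : (Fin n → ℤ) ⧸ L)
      = QuotientAddGroup.mk (fun j => (v j : ℤ)) ↔
    (fun j => (u j : ℤ) - (v j : ℤ)) ∈ L := by
  rw [eq_comm, QuotientAddGroup.eq]
  have : -(fun j => (v j : ℤ)) + (fun j => (u j : ℤ)) = fun j => (u j : ℤ) - (v j : ℤ) := by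
    funext j
    simp [sub_eq_add_neg, add_comm]
  rw [this]

theorem ker_latMap {n : ℕ} (L : AddSubgroup (Fin n → ℤ)) :
    RingHom.ker (latMap L) = latIdeal L := by
  classical
  apply le_antisymm
  · let g : ((Fin n → ℤ) ⧸ L) → (MvPolynomial (Fin n) ℂ ⧸ latIdeal L) := fun q =>
      if h : ∃ u : Fin n → ℕ, (QuotientAddGroup.mk (fun j => (u j : ℤ)) : (Fin n → ℤ) ⧸ L) = q
      then Ideal.Quotient.mk _ (xpow h.choose) else 0
    let ψ := (AddMonoidAlgebra.basis ((Fin n → ℤ) ⧸ L) ℂ).constr ℂ g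
    have key : ψ ∘ₗ (latMap L).toLinearMap = (Ideal.Quotient.mkₐ ℂ (latIdeal L)).toLinearMap := by
      apply (MvPolynomial.basisMonomials (Fin n) ℂ).ext
      intro s
      obtain ⟨u, rfl⟩ := Finsupp.equivFunOnFinite.symm.surjective s
      rw [coe_basisMonomials]
      beta_reduce
      rw [← xpow_eq_monomial]
      simp only [LinearMap.comp_apply, AlgHom.toLinearMap_apply]
      rw [latMap_xpow, ← AddMonoidAlgebra.basis_apply]
      simp only [ψ, Module.Basis.constr_basis]
      have h : ∃ u' : Fin n → ℕ, (QuotientAddGroup.mk (fun j => (u' j : ℤ)) : (Fin n → ℤ) ⧸ L)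
        = QuotientAddGroup.mk (fun j => (u j : ℤ)) := ⟨u, rfl⟩
      simp only [g, dif_pos h]
      rw [Ideal.Quotient.mkₐ_eq_mk, Ideal.Quotient.eq]
      exact Ideal.subset_span ⟨_, _, (mk_eq_iff L _ _).1 h.choose_spec, rfl⟩
    intro f hf
    have := LinearMap.congr_fun key f
    simp only [LinearMap.comp_apply, AlgHom.toLinearMap_apply] at this
    rw [show latMap L f = 0 from hf, map_zero] at this
    exact Ideal.Quotient.eq_zero_iff_mem.1 this.symm
  · rw [latIdeal, Ideal.span_le]
    rintro f ⟨u, v, h, rfl⟩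
    change latMap L _ = 0
    rw [map_sub, latMap_xpow, latMap_xpow, (mk_eq_iff L u v).2 h, sub_self]

theorem xpow_sub_mem_iff {n : ℕ} (L : AddSubgroup (Fin n → ℤ)) (u v : Fin n → ℕ) :
    xpow u - xpow v ∈ latIdeal L ↔ (fun j => (u j : ℤ) - (v j : ℤ)) ∈ L := by
  rw [← ker_latMap, RingHom.mem_ker, map_sub, latMap_xpow, latMap_xpow, sub_eq_zero,
    ← mk_eq_iff]
  exact (AddMonoidAlgebra.of_injective (R := ℂ) (M := ((Fin n → ℤ) ⧸ L))).eq_iff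
    (a := Multiplicative.ofAdd _) (b := Multiplicative.ofAdd _)

theorem latIdeal_isPrime {n : ℕ} (L : AddSubgroup (Fin n → ℤ))
    (hsat : ∀ (u : Fin n → ℤ) (s : ℤ), 0 < s → s • u ∈ L → u ∈ L) : (latIdeal L).IsPrime := by
  have htf : IsAddTorsionFree ((Fin n → ℤ) ⧸ L) := by
    refine ⟨fun m hm a b hab => ?_⟩
    induction a using QuotientAddGroup.induction_on with | _ a
    induction b using QuotientAddGroup.induction_on with | _ b
    apply QuotientAddGroup.eq.2
    have h2 : m • (QuotientAddGroup.mk a : (Fin n → ℤ) ⧸ L) = m • QuotientAddGroup.mk b := hab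
    rw [← QuotientAddGroup.mk_nsmul, ← QuotientAddGroup.mk_nsmul, QuotientAddGroup.eq] at h2
    apply hsat _ m (by positivity)
    rw [smul_add, smul_neg]
    simpa using h2
  have hfin : Module.Finite ℤ ((Fin n → ℤ) ⧸ L) :=
    Module.Finite.of_surjective (QuotientAddGroup.mk' L).toIntLinearMap
      (QuotientAddGroup.mk'_surjective L)
  have hfree : Module.Free ℤ ((Fin n → ℤ) ⧸ L) := Module.free_iff_isTorsionFree.2 inferInstance
  have hus : UniqueSums ((Fin n → ℤ) ⧸ L) :=
    UniqueSums.of_injective_addHom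
      ((Module.Free.chooseBasis ℤ ((Fin n → ℤ) ⧸ L)).repr.toAddEquiv.toAddHom)
      (Module.Free.chooseBasis ℤ ((Fin n → ℤ) ⧸ L)).repr.injective inferInstance
  rw [← ker_latMap]
  exact RingHom.ker_isPrime _

/-- Combinatorial core: no stuck configuration. -/
theorem not_stuck {n k : ℕ} (B : Fin k → Fin n → ℤ)
    (hdom : IsDominatingZ (Matrix.of B)) (c : Fin k → ℤ) (u : Fin n → ℤ) (p : Fin k → Fin n)
    (hu : ∀ j, 0 ≤ u j) :
    ∀ R : Finset (Fin k), R.Nonempty → (∀ i ∈ R, 0 < c i) → (∀ i ∈ R, u (p i) < B i (p i)) →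
      (∀ i ∈ R, ∑ t ∈ R, c t * B t (p i) ≤ u (p i)) → False := by
  classical
  intro R
  induction R using Finset.strongInduction with
  | H R ih =>
    intro hne hc hp hs
    by_cases hmix : ∀ i ∈ R, ∃ j ∈ R.image p, B i j < 0
    · obtain ⟨R', hR', hcard⟩ := Finset.exists_subset_card_eq
        (Finset.card_image_le (s := R) (f := p))
      have hpos : 0 < (R.image p).card := Finset.card_pos.2 (hne.image p)
      let e := R'.equivFinOfCardEq hcard
      let d := (R.image p).equivFin
      refine hdom (R.image p).card hpos (fun a => (e.symm a : Fin k)) (fun a => (d.symm a : Fin n))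
        (Subtype.val_injective.comp e.symm.injective)
        (Subtype.val_injective.comp d.symm.injective) ?_
      intro a
      have ha : (e.symm a : Fin k) ∈ R := hR' (e.symm a).2
      constructor
      · refine ⟨d ⟨p (e.symm a), Finset.mem_image_of_mem p ha⟩, ?_⟩
        simp only [Matrix.submatrix_apply, Matrix.of_apply, Equiv.symm_apply_apply]
        exact lt_of_le_of_lt (hu _) (hp _ ha)
      · obtain ⟨j, hj, hneg⟩ := hmix _ ha
        refine ⟨d ⟨j, hj⟩, ?_⟩
        simpa only [Matrix.submatrix_apply, Matrix.of_apply, Equiv.symm_apply_apply] using hneg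
    · push Not at hmix
      obtain ⟨i, hi, hnn⟩ := hmix
      by_cases hE : (R.erase i).Nonempty
      · refine ih (R.erase i) (Finset.erase_ssubset hi) hE
          (fun t ht => hc t (Finset.mem_of_mem_erase ht))
          (fun t ht => hp t (Finset.mem_of_mem_erase ht)) ?_
        intro t ht
        have ht' := Finset.mem_of_mem_erase ht
        have h1 := hs t ht'
        rw [← Finset.add_sum_erase R _ hi] at h1
        have h2 := mul_nonneg (hc i hi).le (hnn (p t) (Finset.mem_image_of_mem p ht'))
        linarith
      · rw [Finset.not_nonempty_iff_eq_empty] at hE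
        have h1 := hs i hi
        rw [← Finset.add_sum_erase R _ hi, hE] at h1
        have h2 := hp i hi
        have h3 := hc i hi
        have h4 := hu (p i)
        simp only [Finset.sum_empty, add_zero] at h1
        nlinarith

theorem dominating_sign {n k : ℕ} (l : Fin k → Fin n → ℤ)
    (hdom : IsDominatingZ (Matrix.of l)) (ε : Fin k → ℤ) (hε : ∀ i, ε i = 1 ∨ ε i = -1) :
    IsDominatingZ (Matrix.of fun i j => ε i * l i j) := by
  intro m hm r c hr hc hmix
  refine hdom m hm r c hr hc ?_
  intro a
  obtain ⟨⟨j, hj⟩, ⟨j', hj'⟩⟩ := hmix a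
  simp only [Matrix.submatrix_apply, Matrix.of_apply] at hj hj' ⊢
  rcases hε (r a) with h | h <;> rw [h] at hj hj'
  · exact ⟨⟨j, by linarith⟩, ⟨j', by linarith⟩⟩
  · exact ⟨⟨j', by linarith⟩, ⟨j, by linarith⟩⟩

/-- There is always a legal move. -/
theorem exists_move {n k : ℕ} (l : Fin k → Fin n → ℤ) (lp lm : Fin k → Fin n → ℕ)
    (hsplit : ∀ i j, l i j = (lp i j : ℤ) - (lm i j : ℤ))
    (hdisjsupp : ∀ i j, lp i j = 0 ∨ lm i j = 0)
    (hdom : IsDominatingZ (Matrix.of l)) (c : Fin k → ℤ) (hc : c ≠ 0) (u v : Fin n → ℕ)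
    (h : ∀ j, (u j : ℤ) - v j = ∑ i, c i * l i j) :
    ∃ i, (0 < c i ∧ ∀ j, lp i j ≤ u j) ∨ (c i < 0 ∧ ∀ j, lm i j ≤ u j) := by
  classical
  by_contra! hcon
  obtain ⟨i₀, hi₀⟩ := Function.ne_iff.1 hc
  have hn : Nonempty (Fin n) := by
    rcases lt_or_gt_of_ne hi₀ with h0 | h0
    · exact ⟨((hcon i₀).2 h0).choose⟩
    · exact ⟨((hcon i₀).1 h0).choose⟩
  let ε : Fin k → ℤ := fun i => if 0 < c i then 1 else -1
  have hε : ∀ i, ε i = 1 ∨ ε i = -1 := fun i => by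
    by_cases h : 0 < c i <;> simp [ε, h]
  have hp : ∀ i, ∃ j, c i ≠ 0 → (u j : ℤ) < ε i * l i j := by
    intro i
    rcases lt_trichotomy (c i) 0 with h0 | h0 | h0
    · obtain ⟨j, hj⟩ := (hcon i).2 h0
      refine ⟨j, fun _ => ?_⟩
      have := hdisjsupp i j
      simp only [ε, if_neg h0.not_gt, hsplit]
      omega
    · exact ⟨hn.some, fun h => absurd h0 h⟩
    · obtain ⟨j, hj⟩ := (hcon i).1 h0
      refine ⟨j, fun _ => ?_⟩
      have := hdisjsupp i j
      simp only [ε, if_pos h0, hsplit]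
      omega
  choose p hp using hp
  refine not_stuck (fun i j => ε i * l i j) (dominating_sign l hdom ε hε) (fun i => ε i * c i)
    (fun j => (u j : ℤ)) p (fun j => by positivity) (Finset.univ.filter fun i => c i ≠ 0)
    ⟨i₀, by simpa using hi₀⟩ ?_ ?_ ?_
  · intro i hi
    have hi' : c i ≠ 0 := by simpa using hi
    rcases lt_or_gt_of_ne hi' with h0 | h0
    · simp only [ε, if_neg h0.not_gt]
      linarith
    · simp only [ε, if_pos h0]
      linarith
  · intro i hi
    exact hp i (by simpa using hi)
  · intro i _
    have h1 := h (p i)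
    have h2 : ∑ t ∈ Finset.univ.filter (fun i => c i ≠ 0), ε t * c t * (ε t * l t (p i))
        = ∑ t, c t * l t (p i) := by
      rw [Finset.sum_filter]
      refine Finset.sum_congr rfl fun t _ => ?_
      split_ifs with h0
      · rcases hε t with h | h <;> rw [h] <;> ring
      · push Not at h0
        simp [h0]
    change ∑ t ∈ Finset.univ.filter (fun i => c i ≠ 0), ε t * c t * (ε t * l t (p i)) ≤ (u (p i) : ℤ)
    rw [h2, ← h1]
    have : (0 : ℤ) ≤ v (p i) := by positivity
    linarith

theorem connected {n k : ℕ} (l : Fin k → Fin n → ℤ) (lp lm : Fin k → Fin n → ℕ)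
    (hsplit : ∀ i j, l i j = (lp i j : ℤ) - (lm i j : ℤ))
    (hdisjsupp : ∀ i j, lp i j = 0 ∨ lm i j = 0)
    (hdom : IsDominatingZ (Matrix.of l)) (I : Ideal (MvPolynomial (Fin n) ℂ)) (N : ℕ) :
    ∀ (c : Fin k → ℤ) (_ : ∀ i, c i ≠ 0 → xpow (lp i) - xpow (lm i) ∈ I)
      (_ : ∑ i, (c i).natAbs = N) (u v : Fin n → ℕ)
      (_ : ∀ j, (u j : ℤ) - v j = ∑ i, c i * l i j), xpow u - xpow v ∈ I := by
  classical
  induction N with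
  | zero =>
    intro c _ hN u v h
    have hz : ∀ i, c i = 0 := by simpa using hN
    have : u = v := by
      funext j
      have := h j
      simp only [hz, zero_mul, Finset.sum_const_zero] at this
      omega
    simp [this]
  | succ N ih =>
    intro c hI hN u v h
    have hc : c ≠ 0 := by
      rintro rfl
      simp at hN
    obtain ⟨i, hi⟩ := exists_move l lp lm hsplit hdisjsupp hdom c hc u v h
    -- generic step
    have step : ∀ (a b : Fin n → ℕ) (s : ℤ), (∀ j, a j ≤ u j) → xpow a - xpow b ∈ I →
        (∀ j, (a j : ℤ) - b j = s * l i j) → c i ≠ 0 → (c i - s).natAbs + 1 = (c i).natAbs →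
        xpow u - xpow v ∈ I := by
      intro a b s ha hab hs hci hnat
      have hu : xpow u = xpow (u - a) * xpow a := by
        rw [← xpow_add]
        congr 1
        funext j
        have := ha j
        simp only [Pi.add_apply, Pi.sub_apply]
        omega
      have h1 : xpow u - xpow (u - a + b) ∈ I := by
        rw [hu, xpow_add, ← mul_sub]
        exact I.mul_mem_left _ hab
      have h2 : xpow (u - a + b) - xpow v ∈ I := by
        refine ih (Function.update c i (c i - s)) ?_ ?_ _ _ ?_
        · intro t ht
          by_cases hti : t = i
          · subst hti
            exact hI t hci
          · rw [Function.update_of_ne hti] at ht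
            exact hI t ht
        · rw [← Finset.add_sum_erase _ _ (Finset.mem_univ i)] at hN ⊢
          rw [Function.update_self, Finset.sum_congr rfl (g := fun t => (c t).natAbs)]
          · omega
          · intro t ht
            rw [Function.update_of_ne (Finset.ne_of_mem_erase ht)]
        · intro j
          have hj := h j
          rw [← Finset.add_sum_erase _ _ (Finset.mem_univ i)] at hj ⊢
          rw [Function.update_self, Finset.sum_congr rfl (g := fun t => c t * l t j)]
          · have e1 := hs j
            have e2 := ha j
            have e3 : (((u - a + b) j : ℕ) : ℤ) = u j - a j + b j := by
              simp only [Pi.add_apply, Pi.sub_apply]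
              push_cast [e2]
              ring
            rw [e3, sub_mul, ← e1]
            linarith
          · intro t ht
            rw [Function.update_of_ne (Finset.ne_of_mem_erase ht)]
      have := I.add_mem h1 h2
      simpa using this
    rcases hi with ⟨hi, hle⟩ | ⟨hi, hle⟩
    · exact step (lp i) (lm i) 1 hle (hI i hi.ne') (fun j => by rw [hsplit]; ring) hi.ne' (by omega)
    · refine step (lm i) (lp i) (-1) hle ?_ (fun j => by rw [hsplit]; ring) hi.ne (by omega)
      rw [← neg_sub]
      exact I.neg_mem (hI i hi.ne)

/-- The sublattice spanned by a subset of the basis. -/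
def subLat {n k : ℕ} (l : Fin k → Fin n → ℤ) (T : Set (Fin k)) : AddSubgroup (Fin n → ℤ) where
  carrier := {x | ∃ c : Fin k → ℤ, (∀ i, c i ≠ 0 → i ∈ T) ∧ x = ∑ i, c i • l i}
  zero_mem' := ⟨0, fun i hi => absurd rfl hi, by simp⟩
  add_mem' := by
    rintro x y ⟨c, hc, rfl⟩ ⟨d, hd, rfl⟩
    refine ⟨c + d, ?_, by simp [add_smul, Finset.sum_add_distrib]⟩
    intro i hi
    by_cases h : c i = 0
    · exact hd i (fun h' => hi (by simp [h, h']))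
    · exact hc i h
  neg_mem' := by
    rintro x ⟨c, hc, rfl⟩
    refine ⟨-c, fun i hi => hc i ?_, by simp⟩
    intro h
    exact hi (by simp [h])

theorem sum_single_smul {n k : ℕ} (l : Fin k → Fin n → ℤ) (i : Fin k) :
    ∑ t, (Pi.single i 1 : Fin k → ℤ) t • l t = l i := by
  classical
  rw [Finset.sum_eq_single i]
  · simp
  · intro t _ ht
    simp [ht]
  · simp

theorem latIdeal_subLat {n k : ℕ} (l : Fin k → Fin n → ℤ) (lp lm : Fin k → Fin n → ℕ)
    (hsplit : ∀ i j, l i j = (lp i j : ℤ) - (lm i j : ℤ))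
    (hdisjsupp : ∀ i j, lp i j = 0 ∨ lm i j = 0)
    (hdom : IsDominatingZ (Matrix.of l)) (T : Set (Fin k)) :
    latIdeal (subLat l T) = Ideal.span ((fun i => xpow (lp i) - xpow (lm i)) '' T) := by
  classical
  apply le_antisymm
  · rw [latIdeal, Ideal.span_le]
    rintro f ⟨u, v, ⟨c, hc, h⟩, rfl⟩
    refine connected l lp lm hsplit hdisjsupp hdom
      (Ideal.span ((fun i => xpow (lp i) - xpow (lm i)) '' T)) _ c
      (fun i hi => Ideal.subset_span ⟨i, hc i hi, rfl⟩) rfl u v (fun j => ?_)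
    have := congrFun h j
    simpa [Finset.sum_apply] using this
  · rw [Ideal.span_le]
    rintro f ⟨i, hi, rfl⟩
    refine Ideal.subset_span ⟨_, _, ⟨Pi.single i 1, ?_, ?_⟩, rfl⟩
    · intro t ht
      by_cases hti : t = i
      · rwa [hti]
      · simp [hti] at ht
    · rw [sum_single_smul]
      funext j
      rw [hsplit]

/-- Corollary 8.3: for a saturated lattice `L ⊆ ℤⁿ` with
`L ∩ ℕⁿ = {0}` and a basis `l¹,…,lᵏ` whose matrix is mixed dominating, the lattice
ideal equals the lattice basis ideal, the binomials form a regular sequence, and the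
lattice ideal is prime. -/
theorem lattice_basis_ideal_complete_intersection {n k : ℕ}
    (L : AddSubgroup (Fin n → ℤ))
    (hsat : ∀ (u : Fin n → ℤ) (s : ℤ), 0 < s → s • u ∈ L → u ∈ L)
    (hLN : ∀ x ∈ L, (∀ j, 0 ≤ x j) → x = 0)
    (l : Fin k → Fin n → ℤ)
    (hbasis : (∀ i, l i ∈ L) ∧ ∀ x ∈ L, ∃! c : Fin k → ℤ, x = ∑ i, c i • l i)
    (lp lm : Fin k → Fin n → ℕ)
    (hsplit : ∀ i j, l i j = (lp i j : ℤ) - (lm i j : ℤ))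
    (hdisjsupp : ∀ i j, lp i j = 0 ∨ lm i j = 0)
    (hmd : IsMixedZ (Matrix.of l) ∧ IsDominatingZ (Matrix.of l)) :
    Ideal.span {f : MvPolynomial (Fin n) ℂ | ∃ u v : Fin n → ℕ,
        (fun j => (u j : ℤ) - (v j : ℤ)) ∈ L ∧ f = xpow u - xpow v} =
      Ideal.span (Set.range fun i : Fin k => xpow (lp i) - xpow (lm i)) ∧
    RingTheory.Sequence.IsRegular (MvPolynomial (Fin n) ℂ)
      (List.ofFn fun i : Fin k => xpow (lp i) - xpow (lm i)) ∧
    (Ideal.span {f : MvPolynomial (Fin n) ℂ | ∃ u v : Fin n → ℕ,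
        (fun j => (u j : ℤ) - (v j : ℤ)) ∈ L ∧ f = xpow u - xpow v}).IsPrime := by
  classical
  obtain ⟨hmem, hex⟩ := hbasis
  have hdom := hmd.2
  have hsum : ∀ c : Fin k → ℤ, ∑ i, c i • l i ∈ L := fun c =>
    L.sum_mem fun i _ => L.zsmul_mem (hmem i) _
  have huniq : ∀ c d : Fin k → ℤ, ∑ i, c i • l i = ∑ i, d i • l i → c = d := fun c d h =>
    (hex _ (hsum c)).unique rfl h
  have hL : subLat l Set.univ = L := by
    ext x
    constructor
    · rintro ⟨c, -, rfl⟩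
      exact hsum c
    · intro hx
      obtain ⟨c, hc, -⟩ := hex x hx
      exact ⟨c, fun _ _ => trivial, hc⟩
  have hsatT : ∀ T : Set (Fin k), ∀ (u : Fin n → ℤ) (s : ℤ), 0 < s → s • u ∈ subLat l T →
      u ∈ subLat l T := by
    rintro T u s hs ⟨c, hc, h⟩
    have hu : u ∈ L := hsat u s hs (h ▸ hsum c)
    obtain ⟨d, hd, -⟩ := hex u hu
    refine ⟨d, fun i hi => hc i ?_, hd⟩
    have : c = s • d := by
      apply huniq
      rw [← h, hd, Finset.smul_sum]
      simp [mul_smul]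
    rw [this]
    simpa using ⟨hs.ne', hi⟩
  have hprime := fun T => latIdeal_isPrime _ (hsatT T)
  refine ⟨?_, ?_, latIdeal_isPrime L hsat⟩
  · have := latIdeal_subLat l lp lm hsplit hdisjsupp hdom Set.univ
    rwa [hL, Set.image_univ] at this
  have hof : ∀ i, Ideal.ofList ((List.ofFn fun i : Fin k => xpow (lp i) - xpow (lm i)).take i)
      = latIdeal (subLat l {t | (t : ℕ) < i}) := by
    intro i
    rw [latIdeal_subLat l lp lm hsplit hdisjsupp hdom]
    refine congrArg Ideal.span (Set.ext fun f => ?_)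
    change f ∈ List.take _ _ ↔ _
    rw [List.mem_take_iff_getElem]
    simp only [Set.mem_image, List.getElem_ofFn, List.length_ofFn]
    constructor
    · rintro ⟨j, hj, rfl⟩
      exact ⟨⟨j, by omega⟩, show j < i by omega, rfl⟩
    · rintro ⟨t, ht, rfl⟩
      have ht' : (t : ℕ) < i := ht
      exact ⟨t, by have := t.2; omega, rfl⟩
  rw [RingTheory.Sequence.isRegular_iff, RingTheory.Sequence.isWeaklyRegular_iff]
  constructor
  · intro i hi
    have hi' : i < k := by simpa using hi
    rw [hof, Ideal.smul_eq_mul, Ideal.mul_top, List.getElem_ofFn]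
    have hP := hprime {t | (t : ℕ) < i}
    have hnot : xpow (lp ⟨i, hi'⟩) - xpow (lm ⟨i, hi'⟩) ∉ latIdeal (subLat l {t | (t : ℕ) < i}) := by
      rw [xpow_sub_mem_iff]
      rintro ⟨c, hc, h⟩
      have : Pi.single ⟨i, hi'⟩ 1 = c := by
        apply huniq
        rw [← h, sum_single_smul]
        funext j
        rw [hsplit]
      have := hc ⟨i, hi'⟩ (by simp [← this])
      simp at this
    rw [isSMulRegular_iff_right_eq_zero_of_smul]
    intro x hx
    obtain ⟨y, rfl⟩ := Submodule.mkQ_surjective _ x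
    rw [← map_smul] at hx
    rw [Submodule.mkQ_apply, Submodule.Quotient.mk_eq_zero] at hx ⊢
    exact (hP.mem_or_mem hx).resolve_left hnot
  · have h := hof k
    rw [List.take_of_length_le (by simp)] at h
    rw [h, Ideal.smul_eq_mul, Ideal.mul_top]
    exact (hprime _).ne_top.symm
end
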